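/- Let 1 < p < ∞ and α ∈ ℝ. For every f ∈ C_c^∞((0,∞); ℂ) and every x > 0 the principal value defining (K_α f)(x) exists. Moreover, there exists a constant C > 0 such that ‖K_α f‖_{L_p((0,∞))} ≤ C ‖f‖_{L_p((0,∞))} for all f ∈ C_c^∞((0,∞); ℂ) if and only if α ∈ (−1/p, 2 − 1/p). -/

import Mathlib

open MeasureTheory Filter Set
open scoped ENNReal NNReal

/-- The truncated integrals whose principal value limit defines `(K_α f)(x)`,
including the factor `2/π`. -/
noncomputable def KalphaTrunc (α : ℝ) (f : ℝ → ℂ) (x ε : ℝ) : ℂ :=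
  (2 / Real.pi) • ∫ y in {y : ℝ | y ∈ Ioi (0 : ℝ) ∧ ε < |y - x|},
    ((x ^ α * y ^ (1 - α) / (x ^ 2 - y ^ 2) : ℝ)) • f y

/-- `(K_α f)(x)`, defined as the principal value `lim_{ε→0⁺}` of the truncated integrals. -/
noncomputable def Kalpha (α : ℝ) (f : ℝ → ℂ) (x : ℝ) : ℂ :=
  limUnder (nhdsWithin (0 : ℝ) (Ioi 0)) (KalphaTrunc α f x)

/-- Minkowski-type inequality: an average of functions of `L^p` norm at most `N` has `L^p` norm at
most `N` times the total mass. -/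
theorem lintegral_lintegral_rpow_le {X T : Type*} [MeasurableSpace X] [MeasurableSpace T]
    {μ : Measure X} {ν : Measure T} [SFinite μ] [SFinite ν] {p : ℝ} (hp : 1 < p)
    {g : X → T → ℝ≥0∞} (hg : Measurable (Function.uncurry g)) {N : ℝ≥0∞}
    (hN : ∀ᵐ t ∂ν, ∫⁻ x, g x t ^ p ∂μ ≤ N) :
    ∫⁻ x, (∫⁻ t, g x t ∂ν) ^ p ∂μ ≤ ν univ ^ p * N := by
  have hp0 : 0 < p := by linarith
  have hpq : p.HolderConjugate (Real.conjExponent p) := .conjExponent hp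
  have hmeas : ∀ x, Measurable (g x) := fun x => hg.of_uncurry_left
  have step (x : X) : (∫⁻ t, g x t ∂ν) ^ p ≤ (∫⁻ t, g x t ^ p ∂ν) * ν univ ^ (p - 1) := by
    have h := ENNReal.lintegral_mul_le_Lp_mul_Lq ν hpq (hmeas x).aemeasurable
      (aemeasurable_const (b := (1 : ℝ≥0∞)))
    simp only [Pi.mul_apply, mul_one, ENNReal.one_rpow, lintegral_const, one_mul] at h
    calc (∫⁻ t, g x t ∂ν) ^ p
        ≤ ((∫⁻ t, g x t ^ p ∂ν) ^ (1 / p) * ν univ ^ (1 / Real.conjExponent p)) ^ p := by gcongr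
      _ = _ := by
          rw [ENNReal.mul_rpow_of_nonneg _ _ hp0.le, ← ENNReal.rpow_mul, ← ENNReal.rpow_mul]
          congr 2
          · rw [one_div_mul_cancel hp0.ne', ENNReal.rpow_one]
          · rw [Real.conjExponent]
            field_simp
  calc ∫⁻ x, (∫⁻ t, g x t ∂ν) ^ p ∂μ
      ≤ ∫⁻ x, (∫⁻ t, g x t ^ p ∂ν) * ν univ ^ (p - 1) ∂μ := lintegral_mono step
    _ = (∫⁻ x, ∫⁻ t, g x t ^ p ∂ν ∂μ) * ν univ ^ (p - 1) :=
        lintegral_mul_const _ (hg.pow_const p).lintegral_prod_right'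
    _ = (∫⁻ t, ∫⁻ x, g x t ^ p ∂μ ∂ν) * ν univ ^ (p - 1) := by
        rw [lintegral_lintegral_swap (hg.pow_const p).aemeasurable]
    _ ≤ (∫⁻ _, N ∂ν) * ν univ ^ (p - 1) := by gcongr ?_ * _; exact lintegral_mono_ae hN
    _ = ν univ ^ p * N := by
        rw [lintegral_const, mul_assoc, mul_comm]
        congr 1
        nth_rw 1 [← ENNReal.rpow_one (ν univ)]
        rw [← ENNReal.rpow_add_of_nonneg _ _ zero_le_one (by linarith)]
        congr 1
        ring

/-- On the right half-plane, `|Im w|^p` is controlled by `(Re w)^p` and the harmonic function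
`Re (w^p)`. -/
theorem exists_abs_im_rpow_le {p : ℝ} (hp : 1 < p) (hp2 : p ≤ 2) :
    ∃ A B : ℝ, 0 ≤ A ∧ 0 ≤ B ∧ ∀ w : ℂ, 0 < w.re →
      |w.im| ^ p ≤ A * w.re ^ p - B * (w ^ (p : ℂ)).re := by
  have hp0 : 0 < p := by linarith
  have hpi := Real.pi_pos
  obtain ⟨θ₀, h1, h2⟩ : ∃ θ₀, Real.pi / (2 * p) < θ₀ ∧ θ₀ < Real.pi / 2 :=
    exists_between (by
      apply div_lt_div_of_pos_left hpi <;> linarith)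
  have h1' : Real.pi / 2 < p * θ₀ := by
    rw [div_lt_iff₀ (by positivity)] at h1
    linarith
  have hθ₀ : 0 < θ₀ := lt_trans (by positivity) h1
  have hc0 : 0 < Real.cos θ₀ := Real.cos_pos_of_mem_Ioo ⟨by linarith, h2⟩
  have hpθ : p * θ₀ ≤ Real.pi := by nlinarith
  have hc : Real.cos (p * θ₀) < 0 :=
    Real.cos_neg_of_pi_div_two_lt_of_lt h1' (by linarith)
  set B := -(Real.cos (p * θ₀))⁻¹ with hB
  have hB0 : 0 < B := by rw [hB, neg_pos]; exact inv_lt_zero.2 hc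
  set A := (1 + B) / Real.cos θ₀ ^ p with hA
  have hA0 : 0 < A := by positivity
  refine ⟨A, B, hA0.le, hB0.le, fun w hw => ?_⟩
  have hw0 : w ≠ 0 := by rintro rfl; simp at hw
  have hn : 0 < ‖w‖ := norm_pos_iff.2 hw0
  have hre : w.re = ‖w‖ * Real.cos |w.arg| := by
    rw [Real.cos_abs, Complex.cos_arg hw0]; field_simp
  have hpow : (w ^ (p : ℂ)).re = ‖w‖ ^ p * Real.cos (p * |w.arg|) := by
    have : Real.cos (p * |w.arg|) = Real.cos (w.arg * p) := by
      rw [← Real.cos_abs (w.arg * p), abs_mul, abs_of_pos hp0, mul_comm]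
    rw [Complex.cpow_ofReal_re, this]
  have harg : |w.arg| < Real.pi / 2 := Complex.abs_arg_lt_pi_div_two_iff.2 (Or.inl hw)
  have hcos : 0 < Real.cos |w.arg| :=
    Real.cos_pos_of_mem_Ioo ⟨by linarith [abs_nonneg w.arg], harg⟩
  have key : 1 ≤ A * Real.cos |w.arg| ^ p - B * Real.cos (p * |w.arg|) := by
    rcases le_total |w.arg| θ₀ with h | h
    · have h3 : Real.cos θ₀ ≤ Real.cos |w.arg| :=
        Real.cos_le_cos_of_nonneg_of_le_pi (abs_nonneg _) (by linarith) h
      have h4 : Real.cos θ₀ ^ p ≤ Real.cos |w.arg| ^ p := by gcongr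
      have h5 : 1 + B ≤ A * Real.cos |w.arg| ^ p := by
        calc 1 + B = A * Real.cos θ₀ ^ p := by rw [hA]; field_simp
          _ ≤ _ := by gcongr
      nlinarith [Real.cos_le_one (p * |w.arg|)]
    · have h3 : Real.cos (p * |w.arg|) ≤ Real.cos (p * θ₀) :=
        Real.cos_le_cos_of_nonneg_of_le_pi (by positivity) (by nlinarith) (by gcongr)
      have h4 : B * Real.cos (p * θ₀) = -1 := by rw [hB, neg_mul, inv_mul_cancel₀ hc.ne]
      have h5 : 0 ≤ A * Real.cos |w.arg| ^ p := by positivity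
      nlinarith
  calc |w.im| ^ p ≤ ‖w‖ ^ p := by gcongr; exact Complex.abs_im_le_norm w
    _ ≤ ‖w‖ ^ p * (A * Real.cos |w.arg| ^ p - B * Real.cos (p * |w.arg|)) :=
        le_mul_of_one_le_right (by positivity) key
    _ = _ := by
        rw [hpow]
        conv_rhs => rw [hre]
        rw [Real.mul_rpow hn.le hcos.le]
        ring

/-- Bounded measurable functions on the line with bounded support. -/
structure IsBddCompact (f : ℝ → ℝ) : Prop where
  measurable : Measurable f
  bounded : ∃ B, ∀ x, |f x| ≤ B
  support : ∃ M, ∀ x, M < |x| → f x = 0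

namespace IsBddCompact

variable {f : ℝ → ℝ}

theorem memLp (hf : IsBddCompact f) (p : ℝ≥0∞) : MemLp f p := by
  obtain ⟨B, hB⟩ := hf.bounded
  obtain ⟨M, hM⟩ := hf.support
  have h : f = (Icc (-M) M).indicator f := by
    ext x
    by_cases hx : x ∈ Icc (-M) M
    · rw [indicator_of_mem hx]
    · rw [indicator_of_notMem hx, hM]
      by_contra! h
      exact hx (abs_le.1 h)
  rw [h, memLp_indicator_iff_restrict measurableSet_Icc]
  exact MemLp.of_bound hf.measurable.aestronglyMeasurable B (ae_of_all _ hB)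

theorem integrable (hf : IsBddCompact f) : Integrable f := memLp_one_iff_integrable.1 (hf.memLp 1)

theorem posPart (hf : IsBddCompact f) : IsBddCompact fun x => max (f x) 0 := by
  obtain ⟨B, hB⟩ := hf.bounded
  obtain ⟨M, hM⟩ := hf.support
  refine ⟨hf.measurable.max measurable_const, ⟨B, fun x => ?_⟩, ⟨M, fun x hx => by simp [hM x hx]⟩⟩
  rw [abs_of_nonneg (le_max_right _ _)]
  exact max_le ((le_abs_self _).trans (hB x)) ((abs_nonneg _).trans (hB x))

theorem neg (hf : IsBddCompact f) : IsBddCompact fun x => -f x := by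
  obtain ⟨B, hB⟩ := hf.bounded
  obtain ⟨M, hM⟩ := hf.support
  exact ⟨hf.measurable.neg, ⟨B, fun x => by simpa using hB x⟩, ⟨M, fun x hx => by simp [hM x hx]⟩⟩

end IsBddCompact

/-- The Poisson extension of `f` at height `η`, up to a factor `π`. -/
noncomputable def poissonExt (η : ℝ) (f : ℝ → ℝ) (x : ℝ) : ℝ :=
  ∫ y, η / ((x - y) ^ 2 + η ^ 2) * f y

/-- The conjugate Poisson extension of `f` at height `η`, up to a factor `π`. -/
noncomputable def conjPoissonExt (η : ℝ) (f : ℝ → ℝ) (x : ℝ) : ℝ :=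
  ∫ y, (x - y) / ((x - y) ^ 2 + η ^ 2) * f y

/-- The Cauchy transform of `f`, up to a factor. -/
noncomputable def cauchyExt (f : ℝ → ℝ) (z : ℂ) : ℂ := ∫ y, Complex.I / (z - y) * f y

theorem norm_I_div_sub_le {z : ℂ} {d : ℝ} (hd : 0 < d) {y : ℝ} (h : d ≤ ‖z - y‖) :
    ‖Complex.I / (z - y)‖ ≤ d⁻¹ := by
  rw [norm_div, Complex.norm_I, one_div]
  gcongr

theorem im_le_norm_sub (z : ℂ) (y : ℝ) : z.im ≤ ‖z - y‖ := by
  simpa using (le_abs_self _).trans (Complex.abs_im_le_norm (z - y))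

theorem measurable_I_div_sub (z : ℂ) : Measurable fun y : ℝ => Complex.I / (z - y) := by
  fun_prop

theorem integrable_cauchyExt {f : ℝ → ℝ} (hf : Integrable f) {z : ℂ} (hz : 0 < z.im) :
    Integrable fun y => Complex.I / (z - y) * f y :=
  hf.ofReal.bdd_mul (c := z.im⁻¹) (measurable_I_div_sub z).aestronglyMeasurable
    (ae_of_all _ fun y => norm_I_div_sub_le hz (im_le_norm_sub z y))

theorem I_div_sub_eq (z : ℂ) (y : ℝ) :
    (Complex.I / (z - y)).re = z.im / ((z.re - y) ^ 2 + z.im ^ 2) ∧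
    (Complex.I / (z - y)).im = (z.re - y) / ((z.re - y) ^ 2 + z.im ^ 2) := by
  have h : Complex.normSq (z - y) = (z.re - y) ^ 2 + z.im ^ 2 := by
    simp [Complex.normSq_apply]; ring
  constructor
  · simp [Complex.div_re, h]
  · simp [Complex.div_im, h]

theorem re_cauchyExt {f : ℝ → ℝ} (hf : Integrable f) {z : ℂ} (hz : 0 < z.im) :
    (cauchyExt f z).re = poissonExt z.im f z.re := by
  rw [cauchyExt, ← RCLike.re_eq_complex_re, ← integral_re (integrable_cauchyExt hf hz)]
  refine integral_congr_ae (ae_of_all _ fun y => ?_)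
  simp [(I_div_sub_eq z y).1]

theorem im_cauchyExt {f : ℝ → ℝ} (hf : Integrable f) {z : ℂ} (hz : 0 < z.im) :
    (cauchyExt f z).im = conjPoissonExt z.im f z.re := by
  rw [cauchyExt, ← RCLike.im_eq_complex_im, ← integral_im (integrable_cauchyExt hf hz)]
  refine integral_congr_ae (ae_of_all _ fun y => ?_)
  simp [(I_div_sub_eq z y).2]

theorem integrable_poisson {f : ℝ → ℝ} (hf : Integrable f) {η : ℝ} (hη : 0 < η) (x : ℝ) :
    Integrable fun y => η / ((x - y) ^ 2 + η ^ 2) * f y := by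
  have := (integrable_cauchyExt hf (z := x + η * Complex.I) (by simpa using hη)).re
  refine this.congr (ae_of_all _ fun y => ?_)
  simp [(I_div_sub_eq (x + η * Complex.I) y).1]

theorem integrable_conjPoisson {f : ℝ → ℝ} (hf : Integrable f) {η : ℝ} (hη : 0 < η) (x : ℝ) :
    Integrable fun y => (x - y) / ((x - y) ^ 2 + η ^ 2) * f y := by
  have := (integrable_cauchyExt hf (z := x + η * Complex.I) (by simpa using hη)).im
  refine this.congr (ae_of_all _ fun y => ?_)
  simp [(I_div_sub_eq (x + η * Complex.I) y).2]

theorem norm_cauchyExt_le {f : ℝ → ℝ} (hf : Integrable f) {z : ℂ} {d : ℝ} (hd : 0 < d)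
    (h : ∀ y, f y ≠ 0 → d ≤ ‖z - y‖) : ‖cauchyExt f z‖ ≤ d⁻¹ * ∫ y, |f y| := by
  rw [cauchyExt, ← integral_const_mul]
  refine norm_integral_le_of_norm_le (hf.abs.const_mul _) (ae_of_all _ fun y => ?_)
  by_cases hy : f y = 0
  · simp [hy]
  · rw [norm_mul, Complex.norm_real, Real.norm_eq_abs]
    gcongr
    exact norm_I_div_sub_le hd (h y hy)

theorem differentiableAt_cauchyExt {f : ℝ → ℝ} (hf : Integrable f) {z : ℂ} (hz : 0 < z.im) :
    DifferentiableAt ℂ (cauchyExt f) z := by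
  have hball : ∀ w ∈ Metric.ball z (z.im / 2), ∀ y : ℝ, z.im / 2 ≤ ‖w - y‖ := by
    intro w hw y
    have h1 := (Complex.abs_im_le_norm (w - z)).trans_lt (mem_ball_iff_norm.1 hw)
    rw [Complex.sub_im] at h1
    have := im_le_norm_sub w y
    linarith [(abs_lt.1 h1).1]
  have hz2 : 0 < z.im / 2 := by linarith
  refine (hasDerivAt_integral_of_dominated_loc_of_deriv_le (𝕜 := ℂ) (μ := volume)
    (F := fun w y => Complex.I / (w - y) * f y)
    (F' := fun w y => -(Complex.I / (w - y) ^ 2) * f y)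
    (bound := fun y => ((z.im / 2) ^ 2)⁻¹ * |f y|)
    (Metric.ball_mem_nhds z hz2) (Eventually.of_forall fun w => ?_)
    (integrable_cauchyExt hf hz) ?_ (ae_of_all _ fun y w hw => ?_) (hf.abs.const_mul _)
    (ae_of_all _ fun y w hw => ?_)).2.differentiableAt
  · exact (measurable_I_div_sub w).aestronglyMeasurable.mul hf.ofReal.aestronglyMeasurable
  · refine AEStronglyMeasurable.mul ?_ hf.ofReal.aestronglyMeasurable
    exact Measurable.aestronglyMeasurable (by fun_prop)
  · rw [norm_mul, Complex.norm_real, Real.norm_eq_abs, norm_neg, norm_div, Complex.norm_I, one_div,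
      norm_pow]
    gcongr
    exact hball w hw y
  · have hne : w - y ≠ 0 := norm_pos_iff.1 (hz2.trans_le (hball w hw y))
    have h := (((hasDerivAt_id w).sub_const (y : ℂ)).inv hne).const_mul Complex.I
    refine (h.mul_const (f y : ℂ)).congr_deriv ?_ |>.congr_of_eventuallyEq ?_
    · simp [div_eq_mul_inv]
    · exact Eventually.of_forall fun w => by simp [div_eq_mul_inv]

theorem poissonExt_pos {f : ℝ → ℝ} (hf : Integrable f) (h0 : ∀ x, 0 ≤ f x)
    (hpos : ∫ y, f y ≠ 0) {η : ℝ} (hη : 0 < η) (x : ℝ) : 0 < poissonExt η f x := by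
  have h0' : ∀ y, 0 ≤ η / ((x - y) ^ 2 + η ^ 2) * f y := fun y => mul_nonneg (by positivity) (h0 y)
  refine lt_of_le_of_ne (integral_nonneg h0') fun h => hpos ?_
  have h' := (integral_eq_zero_iff_of_nonneg h0' (integrable_poisson hf hη x)).1 h.symm
  refine integral_eq_zero_of_ae (h'.mono fun y hy => ?_)
  have : η / ((x - y) ^ 2 + η ^ 2) ≠ 0 := by positivity
  simpa [this] using hy

theorem eLpNorm_ofReal_eq {X E : Type*} [MeasurableSpace X] [NormedAddCommGroup E] {μ : Measure X}
    {p : ℝ} (hp : 0 < p) (f : X → E) :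
    eLpNorm f (ENNReal.ofReal p) μ = (∫⁻ x, ‖f x‖ₑ ^ p ∂μ) ^ (1 / p) := by
  rw [eLpNorm_eq_lintegral_rpow_enorm_toReal (by simpa using hp) ENNReal.ofReal_ne_top,
    ENNReal.toReal_ofReal hp.le]

theorem tendsto_integral_cauchyExt_cpow {f : ℝ → ℝ} (hf : IsBddCompact f) (h0 : ∀ x, 0 ≤ f x)
    (hpos : ∫ y, f y ≠ 0) {η : ℝ} (hη : 0 < η) {p : ℝ} (hp : 1 < p) :
    Tendsto (fun R : ℝ => ∫ x in (-R)..R, cauchyExt f (x + η * Complex.I) ^ (p : ℂ)) atTop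
      (nhds 0) := by
  have hi := hf.integrable
  obtain ⟨M, hM⟩ := hf.support
  set S := ∫ y, |f y| with hS
  have hS0 : 0 ≤ S := integral_nonneg fun y => abs_nonneg _
  have hlim : Tendsto (fun R : ℝ => 4 * (2 * S) ^ p * R ^ (-(p - 1))) atTop (nhds 0) := by
    simpa using (tendsto_rpow_neg_atTop (y := p - 1) (by linarith)).const_mul (4 * (2 * S) ^ p)
  refine squeeze_zero_norm' ?_ hlim
  filter_upwards [eventually_ge_atTop 1, eventually_ge_atTop (2 * M)] with R hR1 hRM
  have hR : 0 < R := by linarith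
  have hd : DifferentiableOn ℂ (fun z => cauchyExt f z ^ (p : ℂ)) {z | 0 < z.im} := by
    intro z hz
    have hre : 0 < (cauchyExt f z).re := by
      rw [re_cauchyExt hi hz]; exact poissonExt_pos hi h0 hpos hz _
    exact ((differentiableAt_cauchyExt hi hz).cpow_const (Or.inl hre)).differentiableWithinAt
  have hrect := Complex.integral_boundary_rect_eq_zero_of_differentiableOn
    (fun z => cauchyExt f z ^ (p : ℂ)) (-R + η * Complex.I) (R + (η + R : ℝ) * Complex.I)
    (hd.mono (by
      intro z hz
      have hz2 := hz.2
      simp only [Complex.add_im, Complex.neg_im, Complex.ofReal_im, Complex.mul_im, Complex.I_im,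
        Complex.I_re, mem_preimage] at hz2
      rw [uIcc_of_le (by simp; linarith)] at hz2
      have := hz2.1
      simp at this
      exact hη.trans_le this))
  simp only [Complex.add_re, Complex.neg_re, Complex.ofReal_re, Complex.mul_re, Complex.I_re,
    Complex.I_im, Complex.ofReal_im, mul_zero, mul_one, sub_zero, add_zero, Complex.add_im,
    Complex.neg_im, Complex.mul_im, zero_add, neg_zero] at hrect
  have hb : ∀ z : ℂ, (∀ y : ℝ, |y| ≤ M → R / 2 ≤ ‖z - y‖) →
      ‖cauchyExt f z ^ (p : ℂ)‖ ≤ (2 * S / R) ^ p := by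
    intro z hz
    rw [Complex.norm_cpow_real]
    gcongr
    refine (norm_cauchyExt_le hi (d := R / 2) (by positivity) fun y hy => hz y ?_).trans_eq ?_
    · by_contra! h
      exact hy (hM y h)
    · rw [← hS]; field_simp
  have htop : ‖∫ x in (-R)..R, cauchyExt f (x + (η + R : ℝ) * Complex.I) ^ (p : ℂ)‖
      ≤ (2 * S / R) ^ p * (2 * R) := by
    refine (intervalIntegral.norm_integral_le_of_norm_le_const fun x _ => hb _ fun y _ => ?_).trans_eq
      ?_
    · refine le_trans ?_ (im_le_norm_sub _ y)
      simp
      linarith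
    · rw [abs_of_nonneg (by linarith)]; ring
  have hside : ∀ r : ℝ, |r| = R →
      ‖∫ x in η..(η + R), cauchyExt f (r + x * Complex.I) ^ (p : ℂ)‖ ≤ (2 * S / R) ^ p * R := by
    intro r hr
    refine (intervalIntegral.norm_integral_le_of_norm_le_const fun x _ => hb _ fun y hy => ?_).trans_eq
      ?_
    · refine le_trans ?_ (Complex.abs_re_le_norm _)
      have := abs_sub_abs_le_abs_sub r y
      simp
      linarith
    · rw [abs_of_nonneg (by linarith)]; ring
  have h1 := hside R (abs_of_pos hR)
  have h2 := hside (-R) (by rw [abs_neg, abs_of_pos hR])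
  have heq : (4 * (2 * S) ^ p * R ^ (-(p - 1))) = (2 * S / R) ^ p * (4 * R) := by
    rw [Real.div_rpow (by positivity) hR.le, neg_sub, Real.rpow_sub hR, Real.rpow_one]
    ring
  rw [heq]
  push_cast at hrect htop h2
  set b := ∫ x in (-R)..R, cauchyExt f (x + η * Complex.I) ^ (p : ℂ)
  set t := ∫ x in (-R)..R, cauchyExt f (x + (η + R) * Complex.I) ^ (p : ℂ)
  set r := ∫ x in η..(η + R), cauchyExt f (R + x * Complex.I) ^ (p : ℂ)
  set l := ∫ x in η..(η + R), cauchyExt f (-R + x * Complex.I) ^ (p : ℂ)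
  have hbeq : b = t - Complex.I * r + Complex.I * l := by
    simp only [smul_eq_mul] at hrect
    linear_combination hrect
  calc ‖b‖ ≤ ‖t‖ + ‖Complex.I * r‖ + ‖Complex.I * l‖ := by
        rw [hbeq]; exact (norm_add_le _ _).trans (by gcongr; exact norm_sub_le _ _)
    _ ≤ (2 * S / R) ^ p * (2 * R) + (2 * S / R) ^ p * R + (2 * S / R) ^ p * R := by
        simp only [norm_mul, Complex.norm_I, one_mul]; gcongr
    _ = _ := by ring

theorem lintegral_poissonKernel {η : ℝ} (hη : 0 < η) :
    ∫⁻ t : ℝ, ENNReal.ofReal (η / (t ^ 2 + η ^ 2)) = ENNReal.ofReal Real.pi := by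
  have h : (fun t : ℝ => η / (t ^ 2 + η ^ 2)) = fun t => η⁻¹ * (1 + (t / η) ^ 2)⁻¹ := by
    ext t; field_simp; ring
  rw [← ofReal_integral_eq_lintegral_ofReal _ (ae_of_all _ fun t => by positivity), h,
    integral_const_mul, Measure.integral_comp_div (fun t : ℝ => (1 + t ^ 2)⁻¹),
    integral_univ_inv_one_add_sq, abs_of_pos hη, smul_eq_mul, inv_mul_cancel_left₀ hη.ne']
  rw [h]
  exact (integrable_inv_one_add_sq.comp_div hη.ne').const_mul _

theorem lintegral_poissonExt_rpow_le {f : ℝ → ℝ} (hf : Measurable f) {η : ℝ} (hη : 0 < η)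
    {p : ℝ} (hp : 1 < p) :
    ∫⁻ x, ‖poissonExt η f x‖ₑ ^ p ≤ ENNReal.ofReal Real.pi ^ p * ∫⁻ x, ‖f x‖ₑ ^ p := by
  have hk : Measurable fun t : ℝ => ENNReal.ofReal (η / (t ^ 2 + η ^ 2)) := by fun_prop
  set ν : Measure ℝ := volume.withDensity fun t => ENNReal.ofReal (η / (t ^ 2 + η ^ 2)) with hν
  have hνu : ν univ = ENNReal.ofReal Real.pi := by
    rw [hν, withDensity_apply _ MeasurableSet.univ, Measure.restrict_univ,
      lintegral_poissonKernel hη]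
  have hg : Measurable (Function.uncurry fun x t : ℝ => ‖f (x - t)‖ₑ) := by
    simp only [Function.uncurry_def]; fun_prop
  rw [← hνu]
  refine le_trans (lintegral_mono fun x => ?_)
    (lintegral_lintegral_rpow_le hp hg (ae_of_all _ fun t => ?_))
  · gcongr
    calc ‖poissonExt η f x‖ₑ ≤ ∫⁻ y, ‖η / ((x - y) ^ 2 + η ^ 2) * f y‖ₑ :=
          enorm_integral_le_lintegral_enorm _
      _ = ∫⁻ t, ‖η / ((x - (x - t)) ^ 2 + η ^ 2) * f (x - t)‖ₑ :=
          (lintegral_sub_left_eq_self (fun y => ‖η / ((x - y) ^ 2 + η ^ 2) * f y‖ₑ) x).symm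
      _ = ∫⁻ t, ‖f (x - t)‖ₑ ∂ν := by
          rw [hν, lintegral_withDensity_eq_lintegral_mul _ hk (by fun_prop)]
          refine lintegral_congr fun t => ?_
          rw [Pi.mul_apply, enorm_mul, sub_sub_cancel, Real.enorm_of_nonneg (by positivity)]
  · exact (lintegral_sub_right_eq_self (fun x => ‖f x‖ₑ ^ p) t).le

theorem continuous_cauchyExt_line {f : ℝ → ℝ} (hf : Integrable f) {η : ℝ} (hη : 0 < η) :
    Continuous fun x : ℝ => cauchyExt f (x + η * Complex.I) := by
  refine continuous_iff_continuousAt.2 fun x => ?_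
  exact ContinuousAt.comp (f := fun x : ℝ => (x + η * Complex.I : ℂ))
    (differentiableAt_cauchyExt hf (by simpa using hη)).continuousAt (by fun_prop)

theorem continuous_conjPoissonExt {f : ℝ → ℝ} (hf : Integrable f) {η : ℝ} (hη : 0 < η) :
    Continuous (conjPoissonExt η f) := by
  refine (Complex.continuous_im.comp (continuous_cauchyExt_line hf hη)).congr fun x => ?_
  simp [im_cauchyExt hf (z := x + η * Complex.I) (by simpa using hη)]

theorem continuous_poissonExt {f : ℝ → ℝ} (hf : Integrable f) {η : ℝ} (hη : 0 < η) :
    Continuous (poissonExt η f) := by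
  refine (Complex.continuous_re.comp (continuous_cauchyExt_line hf hη)).congr fun x => ?_
  simp [re_cauchyExt hf (z := x + η * Complex.I) (by simpa using hη)]

theorem abs_conjPoissonExt_le {f : ℝ → ℝ} (hf : Integrable f) {η : ℝ} (hη : 0 < η) (x : ℝ) :
    |conjPoissonExt η f x| ≤ η⁻¹ * ∫ y, |f y| := by
  have hz : 0 < (x + η * Complex.I : ℂ).im := by simpa using hη
  have h := im_cauchyExt hf hz
  simp only [Complex.add_im, Complex.ofReal_im, Complex.mul_im, Complex.ofReal_re, Complex.I_im,
    mul_one, Complex.I_re, mul_zero, add_zero, zero_add, Complex.add_re, Complex.mul_re, sub_self]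
    at h
  rw [← h]
  refine (Complex.abs_im_le_norm _).trans (norm_cauchyExt_le hf hη fun y _ => ?_)
  simpa using im_le_norm_sub (x + η * Complex.I) y

theorem lintegral_conjPoissonExt_rpow_le {p : ℝ} (hp : 1 < p) {A B : ℝ} (hA : 0 ≤ A) (hB : 0 ≤ B)
    (hAB : ∀ w : ℂ, 0 < w.re → |w.im| ^ p ≤ A * w.re ^ p - B * (w ^ (p : ℂ)).re)
    {η : ℝ} (hη : 0 < η) {f : ℝ → ℝ} (hf : IsBddCompact f) (h0 : ∀ x, 0 ≤ f x) :
    ∫⁻ x, ‖conjPoissonExt η f x‖ₑ ^ p ≤ ENNReal.ofReal A * ∫⁻ x, ‖poissonExt η f x‖ₑ ^ p := by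
  have hp0 : 0 < p := by linarith
  have hi := hf.integrable
  by_cases hpos : ∫ y, f y = 0
  · have hf0 : f =ᵐ[volume] 0 := (integral_eq_zero_iff_of_nonneg h0 hi).1 hpos
    have : ∀ x, conjPoissonExt η f x = 0 := fun x =>
      integral_eq_zero_of_ae (hf0.mono fun y hy => by simp [hy])
    simp [this, hp0]
  have hPpos := poissonExt_pos hi h0 hpos hη
  have hPc := continuous_poissonExt hi hη
  have hQc := continuous_conjPoissonExt hi hη
  set F : ℝ → ℂ := fun x => cauchyExt f (x + η * Complex.I) with hF
  have hFre : ∀ x, (F x).re = poissonExt η f x := fun x => by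
    simp [hF, re_cauchyExt hi (z := x + η * Complex.I) (by simpa using hη)]
  have hFim : ∀ x, (F x).im = conjPoissonExt η f x := fun x => by
    simp [hF, im_cauchyExt hi (z := x + η * Complex.I) (by simpa using hη)]
  have hFc : Continuous fun x => F x ^ (p : ℂ) := by
    refine (continuous_cauchyExt_line hi hη).cpow continuous_const fun x => Or.inl ?_
    rw [hFre]; exact hPpos x
  have hPp : Continuous fun x => poissonExt η f x ^ p := hPc.rpow_const fun _ => Or.inr hp0.le
  have hQp : Continuous fun x => |conjPoissonExt η f x| ^ p :=
    hQc.abs.rpow_const fun _ => Or.inr hp0.le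
  have henorm : ∀ y : ℝ, ‖y‖ₑ ^ p = ENNReal.ofReal (|y| ^ p) := fun y => by
    rw [Real.enorm_eq_ofReal_abs, ENNReal.ofReal_rpow_of_nonneg (abs_nonneg _) hp0.le]
  have hset : ∀ (R : ℝ), 0 ≤ R → ∀ g : ℝ → ℝ, Continuous g → (∀ x, 0 ≤ g x) →
      ∫⁻ x in Ioc (-R) R, ENNReal.ofReal (g x) = ENNReal.ofReal (∫ x in (-R)..R, g x) := by
    intro R hR g hg hg0
    rw [intervalIntegral.integral_of_le (by linarith), ofReal_integral_eq_lintegral_ofReal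
      ((intervalIntegrable_iff_integrableOn_Ioc_of_le (by linarith)).1 (hg.intervalIntegrable _ _))
      (ae_of_all _ hg0)]
  have hlim := (tendsto_integral_cauchyExt_cpow hf h0 hpos hη hp).norm
  rw [norm_zero] at hlim
  have hlim2 : Tendsto (fun R : ℝ => ENNReal.ofReal A * (∫⁻ x, ‖poissonExt η f x‖ₑ ^ p) +
      ENNReal.ofReal (B * ‖∫ x in (-R)..R, F x ^ (p : ℂ)‖)) atTop
      (nhds (ENNReal.ofReal A * (∫⁻ x, ‖poissonExt η f x‖ₑ ^ p))) := by
    have h := ENNReal.tendsto_ofReal (hlim.const_mul B)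
    rw [mul_zero, ENNReal.ofReal_zero] at h
    simpa using tendsto_const_nhds.add h
  have hcover := (aecover_Ioc (μ := volume) (a := fun R : ℝ => -R) (b := fun R => R)
    tendsto_neg_atTop_atBot tendsto_id).lintegral_tendsto_of_countably_generated
    (f := fun x => ‖conjPoissonExt η f x‖ₑ ^ p) (hQc.measurable.enorm.pow_const p).aemeasurable
  refine le_of_tendsto_of_tendsto hcover hlim2 ?_
  filter_upwards [eventually_ge_atTop 0] with R hR
  calc ∫⁻ x in Ioc (-R) R, ‖conjPoissonExt η f x‖ₑ ^ p
      = ENNReal.ofReal (∫ x in (-R)..R, |conjPoissonExt η f x| ^ p) := by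
        simp only [henorm]
        exact hset R hR _ hQp fun x => by positivity
    _ ≤ ENNReal.ofReal (A * (∫ x in (-R)..R, poissonExt η f x ^ p) +
          B * ‖∫ x in (-R)..R, F x ^ (p : ℂ)‖) := by
        refine ENNReal.ofReal_le_ofReal ?_
        have hre : ∫ x in (-R)..R, (F x ^ (p : ℂ)).re = (∫ x in (-R)..R, F x ^ (p : ℂ)).re :=
          Complex.reCLM.intervalIntegral_comp_comm (hFc.intervalIntegrable _ _)
        have hrei : IntervalIntegrable (fun x => (F x ^ (p : ℂ)).re) volume (-R) R :=
          (Complex.continuous_re.comp hFc).intervalIntegrable _ _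
        calc ∫ x in (-R)..R, |conjPoissonExt η f x| ^ p
            ≤ ∫ x in (-R)..R, (A * poissonExt η f x ^ p - B * (F x ^ (p : ℂ)).re) := by
              refine intervalIntegral.integral_mono_on (by linarith) (hQp.intervalIntegrable _ _)
                (((hPp.intervalIntegrable _ _).const_mul A).sub (hrei.const_mul B)) fun x _ => ?_
              rw [← hFre, ← hFim]
              exact hAB _ (by rw [hFre]; exact hPpos x)
          _ = A * (∫ x in (-R)..R, poissonExt η f x ^ p)
              - B * (∫ x in (-R)..R, F x ^ (p : ℂ)).re := by
              rw [intervalIntegral.integral_sub ((hPp.intervalIntegrable _ _).const_mul A)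
                (hrei.const_mul B), intervalIntegral.integral_const_mul,
                intervalIntegral.integral_const_mul, hre]
          _ ≤ _ := by
              have := (abs_le.1 (Complex.abs_re_le_norm (∫ x in (-R)..R, F x ^ (p : ℂ)))).1
              nlinarith
    _ ≤ ENNReal.ofReal A * ENNReal.ofReal (∫ x in (-R)..R, poissonExt η f x ^ p) +
          ENNReal.ofReal (B * ‖∫ x in (-R)..R, F x ^ (p : ℂ)‖) := by
        rw [← ENNReal.ofReal_mul hA]
        exact ENNReal.ofReal_add_le
    _ ≤ _ := by
        gcongr
        rw [← hset R hR _ hPp fun x => Real.rpow_nonneg (hPpos x).le _]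
        simp only [henorm, abs_of_pos (hPpos _)]
        exact setLIntegral_le_lintegral _ _

theorem conjPoissonExt_posPart_sub {f : ℝ → ℝ} (hf : IsBddCompact f) {η : ℝ} (hη : 0 < η) :
    conjPoissonExt η f = conjPoissonExt η (fun x => max (f x) 0) -
      conjPoissonExt η (fun x => max (-f x) 0) := by
  ext x
  rw [Pi.sub_apply, conjPoissonExt, conjPoissonExt, conjPoissonExt,
    ← integral_sub (integrable_conjPoisson hf.posPart.integrable hη x)
      (integrable_conjPoisson hf.neg.posPart.integrable hη x)]
  refine integral_congr_ae (ae_of_all _ fun y => ?_)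
  have : f y = max (f y) 0 - max (-f y) 0 := by
    rcases le_total 0 (f y) with h | h
    · simp [h]
    · simp [h]
  simp only [← mul_sub, ← this]

theorem exists_eLpNorm_conjPoissonExt_le_of_le_two {p : ℝ} (hp : 1 < p) (hp2 : p ≤ 2) :
    ∃ C : ℝ≥0, ∀ η : ℝ, 0 < η → ∀ f, IsBddCompact f →
      eLpNorm (conjPoissonExt η f) (ENNReal.ofReal p) volume
        ≤ C * eLpNorm f (ENNReal.ofReal p) volume := by
  obtain ⟨A, B, hA, hB, hAB⟩ := exists_abs_im_rpow_le hp hp2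
  have hp0 : 0 < p := by linarith
  set D : ℝ≥0∞ := (ENNReal.ofReal A * ENNReal.ofReal Real.pi ^ p) ^ (1 / p) with hD
  have hDtop : D ≠ ∞ := by
    refine ENNReal.rpow_ne_top_of_nonneg (by positivity) (ENNReal.mul_ne_top ENNReal.ofReal_ne_top ?_)
    exact ENNReal.rpow_ne_top_of_nonneg hp0.le ENNReal.ofReal_ne_top
  have hnn : ∀ η : ℝ, 0 < η → ∀ f, IsBddCompact f → (∀ x, 0 ≤ f x) →
      eLpNorm (conjPoissonExt η f) (ENNReal.ofReal p) volume
        ≤ D * eLpNorm f (ENNReal.ofReal p) volume := by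
    intro η hη f hf h0
    rw [eLpNorm_ofReal_eq hp0, eLpNorm_ofReal_eq hp0, hD,
      ← ENNReal.mul_rpow_of_nonneg _ _ (by positivity), mul_assoc]
    gcongr
    exact (lintegral_conjPoissonExt_rpow_le hp hA hB hAB hη hf h0).trans
      (by gcongr; exact lintegral_poissonExt_rpow_le hf.measurable hη hp)
  refine ⟨2 * D.toNNReal, fun η hη f hf => ?_⟩
  have hq : 1 ≤ ENNReal.ofReal p := by simpa using hp.le
  rw [conjPoissonExt_posPart_sub hf hη]
  have hpart : ∀ g, IsBddCompact g → (∀ x, |g x| = |f x|) →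
      eLpNorm (conjPoissonExt η fun x => max (g x) 0) (ENNReal.ofReal p) volume
        ≤ D * eLpNorm f (ENNReal.ofReal p) volume := by
    intro g hg hgf
    refine (hnn η hη _ hg.posPart fun x => le_max_right _ _).trans ?_
    gcongr
    refine eLpNorm_mono fun x => ?_
    rw [Real.norm_eq_abs, Real.norm_eq_abs, ← hgf, abs_of_nonneg (le_max_right _ _)]
    exact max_le (le_abs_self _) (abs_nonneg _)
  refine (eLpNorm_sub_le
    (continuous_conjPoissonExt hf.posPart.integrable hη).aestronglyMeasurable
    (continuous_conjPoissonExt hf.neg.posPart.integrable hη).aestronglyMeasurable hq).trans ?_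
  refine (add_le_add (hpart f hf fun _ => rfl) (hpart _ hf.neg fun x => abs_neg _)).trans_eq ?_
  rw [ENNReal.coe_mul, ENNReal.coe_toNNReal hDtop]
  push_cast
  ring

theorem abs_div_sq_add_sq_le {η : ℝ} (hη : 0 < η) (t : ℝ) : |t / (t ^ 2 + η ^ 2)| ≤ η⁻¹ := by
  rw [abs_div, abs_of_pos (a := t ^ 2 + η ^ 2) (by positivity), div_le_iff₀ (by positivity),
    ← sq_abs t, inv_mul_eq_div, le_div_iff₀ hη]
  nlinarith [sq_nonneg (|t| - η), abs_nonneg t, mul_nonneg (abs_nonneg t) hη.le]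

theorem integral_conjPoissonExt_mul {f g : ℝ → ℝ} (hf : Integrable f) (hg : Integrable g)
    {η : ℝ} (hη : 0 < η) :
    ∫ x, conjPoissonExt η f x * g x = -∫ x, f x * conjPoissonExt η g x := by
  have hInt : Integrable (fun z : ℝ × ℝ => (z.1 - z.2) / ((z.1 - z.2) ^ 2 + η ^ 2) *
      (g z.1 * f z.2)) (volume.prod volume) :=
    (hg.mul_prod hf).bdd_mul (c := η⁻¹) (Measurable.aestronglyMeasurable (by fun_prop))
      (ae_of_all _ fun z => abs_div_sq_add_sq_le hη _)
  calc ∫ x, conjPoissonExt η f x * g x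
      = ∫ x, ∫ y, (x - y) / ((x - y) ^ 2 + η ^ 2) * (g x * f y) := by
        refine integral_congr_ae (ae_of_all _ fun x => ?_)
        simp only [conjPoissonExt]
        rw [← integral_mul_const]
        congr 1; ext y; ring
    _ = ∫ y, ∫ x, (x - y) / ((x - y) ^ 2 + η ^ 2) * (g x * f y) := integral_integral_swap hInt
    _ = ∫ y, -(f y * conjPoissonExt η g y) := by
        refine integral_congr_ae (ae_of_all _ fun y => ?_)
        simp only [conjPoissonExt]
        rw [← integral_const_mul, ← integral_neg]
        congr 1; ext x
        rw [← neg_sub x y, neg_sq]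
        ring
    _ = _ := integral_neg _

theorem exists_eLpNorm_conjPoissonExt_le_of_two_le {p : ℝ} (hp2 : 2 ≤ p) :
    ∃ C : ℝ≥0, ∀ η : ℝ, 0 < η → ∀ f, IsBddCompact f →
      eLpNorm (conjPoissonExt η f) (ENNReal.ofReal p) volume
        ≤ C * eLpNorm f (ENNReal.ofReal p) volume := by
  have hp : 1 < p := by linarith
  have hp0 : 0 < p := by linarith
  set q := Real.conjExponent p with hqdef
  have hpq : p.HolderConjugate q := .conjExponent hp
  have hq0 : 0 < q := hpq.symm.pos
  have hq2 : q ≤ 2 := by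
    rw [hqdef, Real.conjExponent, div_le_iff₀ (by linarith)]; linarith
  obtain ⟨C, hC⟩ := exists_eLpNorm_conjPoissonExt_le_of_le_two hpq.symm.lt hq2
  refine ⟨C, fun η hη f hf => ?_⟩
  have hi := hf.integrable
  set h := conjPoissonExt η f with hh
  have hhc : Continuous h := continuous_conjPoissonExt hi hη
  have hpc : Continuous fun x => |h x| ^ p := hhc.abs.rpow_const fun _ => Or.inr hp0.le
  have hcover := (aecover_Icc (μ := volume) (a := fun R : ℝ => -R) (b := fun R => R)
    tendsto_neg_atTop_atBot tendsto_id).lintegral_tendsto_of_countably_generated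
    (f := fun x => ‖h x‖ₑ ^ p) (hhc.measurable.enorm.pow_const p).aemeasurable
  rw [eLpNorm_ofReal_eq hp0 h]
  refine le_of_tendsto (((ENNReal.continuous_rpow_const).tendsto _).comp hcover)
    (Eventually.of_forall fun R => ?_)
  simp only [Function.comp_apply]
  set J := ∫⁻ x in Icc (-R) R, ‖h x‖ₑ ^ p with hJ
  have henorm : ∀ y : ℝ, ‖y‖ₑ ^ p = ENNReal.ofReal (|y| ^ p) := fun y => by
    rw [Real.enorm_eq_ofReal_abs, ENNReal.ofReal_rpow_of_nonneg (abs_nonneg _) hp0.le]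
  have hJreal : J = ENNReal.ofReal (∫ x in Icc (-R) R, |h x| ^ p) := by
    rw [hJ, ofReal_integral_eq_lintegral_ofReal hpc.continuousOn.integrableOn_Icc
      (ae_of_all _ fun x => by positivity)]
    simp only [henorm]
  have hJtop : J ≠ ∞ := by rw [hJreal]; exact ENNReal.ofReal_ne_top
  set g : ℝ → ℝ := (Icc (-R) R).indicator fun x => h x * |h x| ^ (p - 2) with hg
  have hgabs : ∀ x, |h x * |h x| ^ (p - 2)| = |h x| ^ (p - 1) := fun x => by
    rw [abs_mul, abs_of_nonneg (a := |h x| ^ (p - 2)) (by positivity),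
      ← Real.rpow_one_add' (abs_nonneg _) (by linarith)]
    congr 1; ring
  have hgb : IsBddCompact g := by
    refine ⟨?_, ⟨(η⁻¹ * ∫ y, |f y|) ^ (p - 1), fun x => ?_⟩, ⟨R, fun x hx => ?_⟩⟩
    · exact (hhc.mul (hhc.abs.rpow_const fun _ => Or.inr (by linarith))).measurable.indicator
        measurableSet_Icc
    · have hb : 0 ≤ η⁻¹ * ∫ y, |f y| := by positivity
      by_cases hx : x ∈ Icc (-R) R
      · rw [hg, indicator_of_mem hx, hgabs]
        exact Real.rpow_le_rpow (abs_nonneg _) (abs_conjPoissonExt_le hi hη x) (by linarith)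
      · rw [hg, indicator_of_notMem hx, abs_zero]
        positivity
    · rw [hg, indicator_of_notMem]
      exact fun hx' => (abs_le.2 hx').not_gt hx
  have hgq : eLpNorm g (ENNReal.ofReal q) volume = J ^ (1 / q) := by
    rw [eLpNorm_ofReal_eq hq0, hJ, ← lintegral_indicator measurableSet_Icc]
    congr 2; ext x
    by_cases hx : x ∈ Icc (-R) R
    · rw [hg, indicator_of_mem hx, indicator_of_mem hx, Real.enorm_eq_ofReal_abs, hgabs, henorm,
        ENNReal.ofReal_rpow_of_nonneg (by positivity) hq0.le, ← Real.rpow_mul (abs_nonneg _),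
        hpq.sub_one_mul_conj]
    · rw [hg, indicator_of_notMem hx, indicator_of_notMem hx]
      simp [hq0]
  have hmain : J ≤ (C * eLpNorm f (ENNReal.ofReal p) volume) * J ^ (1 / q) := by
    have h1 : ∫ x in Icc (-R) R, |h x| ^ p = ∫ x, h x * g x := by
      rw [← integral_indicator measurableSet_Icc]
      congr 1; ext x
      by_cases hx : x ∈ Icc (-R) R
      · rw [hg, indicator_of_mem hx, indicator_of_mem hx, ← mul_assoc, ← abs_mul_abs_self, mul_assoc,
          ← Real.rpow_one_add' (abs_nonneg _) (by linarith),
          ← Real.rpow_one_add' (abs_nonneg _) (by linarith)]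
        congr 1; ring
      · rw [hg, indicator_of_notMem hx, indicator_of_notMem hx, mul_zero]
    calc J ≤ ‖∫ x, h x * g x‖ₑ := by
          rw [hJreal, h1, Real.enorm_eq_ofReal_abs]; exact ENNReal.ofReal_le_ofReal (le_abs_self _)
      _ = ‖∫ x, f x * conjPoissonExt η g x‖ₑ := by
          rw [integral_conjPoissonExt_mul hi hgb.integrable hη, enorm_neg]
      _ ≤ ∫⁻ x, ‖f x * conjPoissonExt η g x‖ₑ := enorm_integral_le_lintegral_enorm _
      _ = ∫⁻ x, ((fun x => ‖f x‖ₑ) * fun x => ‖conjPoissonExt η g x‖ₑ) x := by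
          simp only [enorm_mul, Pi.mul_apply]
      _ ≤ eLpNorm f (ENNReal.ofReal p) volume *
            eLpNorm (conjPoissonExt η g) (ENNReal.ofReal q) volume := by
          rw [eLpNorm_ofReal_eq hp0, eLpNorm_ofReal_eq hq0]
          exact ENNReal.lintegral_mul_le_Lp_mul_Lq _ hpq hf.measurable.enorm.aemeasurable
            (continuous_conjPoissonExt hgb.integrable hη).measurable.enorm.aemeasurable
      _ ≤ eLpNorm f (ENNReal.ofReal p) volume * (C * J ^ (1 / q)) := by
          gcongr
          exact (hC η hη g hgb).trans_eq (by rw [hgq])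
      _ = _ := by ring
  by_cases hJ0 : J = 0
  · simp [hJ0, hp0]
  have hJq0 : J ^ (1 / q) ≠ 0 := by simp [ENNReal.rpow_eq_zero_iff, hJ0, hJtop]
  have hJqt : J ^ (1 / q) ≠ ∞ := ENNReal.rpow_ne_top_of_nonneg (by positivity) hJtop
  rw [← ENNReal.mul_le_mul_iff_left hJq0 hJqt, ← ENNReal.rpow_add _ _ hJ0 hJtop]
  have : 1 / p + 1 / q = 1 := by simpa using hpq.inv_add_inv_eq_one
  rw [this, ENNReal.rpow_one]
  exact hmain

theorem exists_eLpNorm_conjPoissonExt_le {p : ℝ} (hp : 1 < p) :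
    ∃ C : ℝ≥0, ∀ η : ℝ, 0 < η → ∀ f, IsBddCompact f →
      eLpNorm (conjPoissonExt η f) (ENNReal.ofReal p) volume
        ≤ C * eLpNorm f (ENNReal.ofReal p) volume :=
  (le_total p 2).elim (exists_eLpNorm_conjPoissonExt_le_of_le_two hp)
    exists_eLpNorm_conjPoissonExt_le_of_two_le

section HilbertTransform

variable {E : Type*} [NormedAddCommGroup E] [NormedSpace ℝ E]

/-- The principal value of `∫ φ y / (x - y) dy`, written as an absolutely convergent integral. -/
noncomputable def hilbertPV (φ : ℝ → E) (x : ℝ) : E :=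
  ∫ t in Ioi (0 : ℝ), t⁻¹ • (φ (x - t) - φ (x + t))

theorem integral_odd_kernel {φ : ℝ → E} {k : ℝ → ℝ} (hk : ∀ t, k (-t) = -k t) (x : ℝ)
    (hInt : Integrable fun y => k (x - y) • φ y) :
    ∫ y, k (x - y) • φ y = ∫ t in Ioi (0 : ℝ), k t • (φ (x - t) - φ (x + t)) := by
  have h1 : Integrable fun t => k t • φ (x - t) := by
    simpa using hInt.comp_sub_left x
  have h2 : Integrable fun t => k (-t) • φ (x + t) := by
    simpa using h1.comp_neg
  have h3 : ∫ t in Iic (0 : ℝ), k t • φ (x - t) = ∫ t in Ioi (0 : ℝ), k (-t) • φ (x + t) := by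
    have := integral_comp_neg_Ioi (0 : ℝ) fun t => k t • φ (x - t)
    simpa using this.symm
  calc ∫ y, k (x - y) • φ y = ∫ t, k t • φ (x - t) := by
        simpa using (integral_sub_left_eq_self (fun y => k (x - y) • φ y) volume x).symm
    _ = (∫ t in Iic (0 : ℝ), k t • φ (x - t)) + ∫ t in Ioi (0 : ℝ), k t • φ (x - t) :=
        (intervalIntegral.integral_Iic_add_Ioi h1.integrableOn h1.integrableOn).symm
    _ = _ := by
        rw [h3, ← integral_add h2.integrableOn h1.integrableOn]
        congr 1; ext t
        rw [hk, neg_smul, smul_sub]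
        abel

theorem integrableOn_hilbertPV {φ : ℝ → E} {L : ℝ≥0} (hL : LipschitzWith L φ)
    (hc : HasCompactSupport φ) (x : ℝ) :
    IntegrableOn (fun t => t⁻¹ • (φ (x - t) - φ (x + t))) (Ioi 0) := by
  obtain ⟨M, hM⟩ := hc.isCompact.isBounded.exists_norm_le
  have hz : ∀ y, M < |y| → φ y = 0 := fun y hy => by
    by_contra h
    exact (hM y (subset_tsupport _ h)).not_gt hy
  have hcont := hL.continuous
  have hmeas : AEStronglyMeasurable (fun t : ℝ => t⁻¹ • (φ (x - t) - φ (x + t))) volume :=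
    AEStronglyMeasurable.smul (by fun_prop) (Continuous.aestronglyMeasurable (by fun_prop))
  have hb : ∀ t, ‖t⁻¹ • (φ (x - t) - φ (x + t))‖ ≤ 2 * L := by
    intro t
    have h := hL.dist_le_mul (x - t) (x + t)
    rw [dist_eq_norm, Real.dist_eq, show x - t - (x + t) = -(2 * t) by ring,
      abs_neg, abs_mul, abs_two] at h
    rw [norm_smul, norm_inv, Real.norm_eq_abs]
    rcases eq_or_ne t 0 with rfl | ht
    · simp
    · rw [inv_mul_le_iff₀ (abs_pos.2 ht)]
      linarith
  have hzero : ∀ t ∈ Ioi 0, t ∉ Ioc 0 (M + |x|) → t⁻¹ • (φ (x - t) - φ (x + t)) = 0 := by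
    intro t ht ht'
    have ht0 : 0 < t := ht
    have ht2 : M + |x| < t := by
      by_contra! h
      exact ht' ⟨ht, h⟩
    have h1 := abs_sub_abs_le_abs_sub t x
    have h2 := abs_sub_abs_le_abs_sub t (-x)
    rw [abs_of_pos ht0] at h1 h2
    rw [abs_neg, sub_neg_eq_add, add_comm t x] at h2
    rw [hz (x - t) (by rw [abs_sub_comm]; linarith), hz (x + t) (by linarith), sub_zero, smul_zero]
  refine IntegrableOn.of_forall_sdiff_eq_zero (s := Ioc 0 (M + |x|)) ?_ measurableSet_Ioi
    fun t ht => hzero t ht.1 ht.2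
  exact Measure.integrableOn_of_bounded (by simp) hmeas (ae_of_all _ hb)

theorem tendsto_hilbertPV {φ : ℝ → E} {L : ℝ≥0} (hL : LipschitzWith L φ)
    (hc : HasCompactSupport φ) (x : ℝ) {ι : Type*} {l : Filter ι} [l.IsCountablyGenerated]
    {k : ι → ℝ → ℝ} (hodd : ∀ s t, k s (-t) = -k s t) (hmeas : ∀ s, Measurable (k s))
    (hbdd : ∀ᶠ s in l, ∃ B, ∀ t, |k s t| ≤ B) (hle : ∀ s, ∀ t, 0 < t → |k s t| ≤ t⁻¹)
    (hlim : ∀ t, 0 < t → Tendsto (fun s => k s t) l (nhds t⁻¹)) :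
    Tendsto (fun s => ∫ y, k s (x - y) • φ y) l (nhds (hilbertPV φ x)) := by
  have hcont := hL.continuous
  have hφ : Integrable φ := hcont.integrable_of_hasCompactSupport hc
  have hev : ∀ᶠ s in l, ∫ t in Ioi (0 : ℝ), k s t • (φ (x - t) - φ (x + t))
      = ∫ y, k s (x - y) • φ y := by
    filter_upwards [hbdd] with s ⟨B, hB⟩
    refine (integral_odd_kernel (hodd s) x ?_).symm
    exact hφ.bdd_smul B
      ((hmeas s).comp (measurable_const.sub measurable_id)).aestronglyMeasurable
      (ae_of_all _ fun y => hB _)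
  refine Tendsto.congr' hev ?_
  refine tendsto_integral_filter_of_dominated_convergence
    (fun t => ‖t⁻¹ • (φ (x - t) - φ (x + t))‖) (Eventually.of_forall fun s => ?_)
    (Eventually.of_forall fun s => ?_) (integrableOn_hilbertPV hL hc x).norm ?_
  · exact (hmeas s).aestronglyMeasurable.smul (Continuous.aestronglyMeasurable (by fun_prop))
  · refine ae_restrict_of_forall_mem measurableSet_Ioi fun t ht => ?_
    rw [norm_smul, norm_smul]
    gcongr
    exact (hle s t ht).trans (le_abs_self _)
  · exact ae_restrict_of_forall_mem measurableSet_Ioi fun t ht => (hlim t ht).smul_const _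

theorem tendsto_hilbertPV_trunc {φ : ℝ → E} {L : ℝ≥0} (hL : LipschitzWith L φ)
    (hc : HasCompactSupport φ) (x : ℝ) :
    Tendsto (fun ε : ℝ => ∫ y, (if ε < |x - y| then (x - y)⁻¹ else 0) • φ y)
      (nhdsWithin 0 (Ioi 0)) (nhds (hilbertPV φ x)) := by
  refine tendsto_hilbertPV hL hc x (k := fun ε t => if ε < |t| then t⁻¹ else 0) ?_ ?_ ?_ ?_ ?_
  · intro s t
    simp only [abs_neg, inv_neg]
    split_ifs <;> simp
  · intro s
    exact Measurable.ite (measurableSet_lt measurable_const measurable_id.abs)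
      measurable_inv measurable_const
  · filter_upwards [self_mem_nhdsWithin] with ε hε
    have hε : 0 < ε := hε
    refine ⟨ε⁻¹, fun t => ?_⟩
    split_ifs with h
    · rw [abs_inv]
      gcongr
    · simpa using hε.le
  · intro s t ht
    split_ifs
    · rw [abs_of_pos (inv_pos.2 ht)]
    · simpa using ht.le
  · intro t ht
    refine tendsto_const_nhds.congr' ?_
    filter_upwards [nhdsWithin_le_nhds (Iio_mem_nhds ht)] with ε hε
    have hε : ε < t := hε
    rw [if_pos (by rwa [abs_of_pos ht])]

theorem tendsto_hilbertPV_conjPoisson {φ : ℝ → E} {L : ℝ≥0} (hL : LipschitzWith L φ)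
    (hc : HasCompactSupport φ) (x : ℝ) :
    Tendsto (fun n : ℕ => ∫ y, ((x - y) / ((x - y) ^ 2 + (1 / ((n : ℝ) + 1)) ^ 2)) • φ y)
      atTop (nhds (hilbertPV φ x)) := by
  refine tendsto_hilbertPV hL hc x
    (k := fun (n : ℕ) t => t / (t ^ 2 + (1 / ((n : ℝ) + 1)) ^ 2)) ?_ ?_ ?_ ?_ ?_
  · intro s t
    rw [neg_sq, neg_div]
  · intro s
    fun_prop
  · exact Eventually.of_forall fun n => ⟨_, abs_div_sq_add_sq_le Nat.one_div_pos_of_nat⟩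
  · intro s t ht
    rw [abs_of_pos (by positivity), div_le_iff₀ (by positivity), inv_mul_eq_div, le_div_iff₀ ht]
    nlinarith [sq_nonneg (1 / ((s : ℝ) + 1))]
  · intro t ht
    have h : Tendsto (fun n : ℕ => t / (t ^ 2 + (1 / ((n : ℝ) + 1)) ^ 2)) atTop
        (nhds (t / (t ^ 2 + 0 ^ 2))) :=
      tendsto_const_nhds.div (tendsto_const_nhds.add
        (tendsto_one_div_add_atTop_nhds_zero_nat.pow 2)) (by positivity)
    convert h using 2
    field_simp
    ring

end HilbertTransform

theorem isBddCompact_of_continuous {f : ℝ → ℝ} (hf : Continuous f) (hc : HasCompactSupport f) :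
    IsBddCompact f := by
  obtain ⟨M, hM⟩ := hc.isCompact.isBounded.exists_norm_le
  refine ⟨hf.measurable, ?_, M, fun y hy => ?_⟩
  · exact hc.exists_bound_of_continuous hf
  · by_contra h
    exact (hM y (subset_tsupport _ h)).not_gt hy

theorem exists_eLpNorm_hilbertPV_le {p : ℝ} (hp : 1 < p) :
    ∃ C : ℝ≥0, ∀ f : ℝ → ℂ, (∃ L, LipschitzWith L f) → HasCompactSupport f →
      AEStronglyMeasurable (hilbertPV f) volume ∧
      eLpNorm (hilbertPV f) (ENNReal.ofReal p) volume
        ≤ C * eLpNorm f (ENNReal.ofReal p) volume := by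
  obtain ⟨C, hC⟩ := exists_eLpNorm_conjPoissonExt_le hp
  refine ⟨2 * C, fun f ⟨L, hL⟩ hc => ?_⟩
  have hcont := hL.continuous
  have hq : 1 ≤ ENNReal.ofReal p := by simpa using hp.le
  have hInt : Integrable f := hcont.integrable_of_hasCompactSupport hc
  have hre : IsBddCompact fun y => (f y).re :=
    isBddCompact_of_continuous (Complex.continuous_re.comp hcont) (hc.comp_left Complex.zero_re)
  have him : IsBddCompact fun y => (f y).im :=
    isBddCompact_of_continuous (Complex.continuous_im.comp hcont) (hc.comp_left Complex.zero_im)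
  have hdecomp : ∀ η : ℝ, 0 < η → (fun x => ∫ y, ((x - y) / ((x - y) ^ 2 + η ^ 2)) • f y) =
      (fun x => (conjPoissonExt η (fun y => (f y).re) x : ℂ)) +
        fun x => Complex.I * (conjPoissonExt η (fun y => (f y).im) x : ℂ) := by
    intro η hη
    ext x
    rw [Pi.add_apply, conjPoissonExt, conjPoissonExt, ← integral_complex_ofReal, ← integral_complex_ofReal,
      ← integral_const_mul, ← integral_add (integrable_conjPoisson hre.integrable hη x).ofReal
        ((integrable_conjPoisson him.integrable hη x).ofReal.const_mul _)]
    congr 1; ext y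
    apply Complex.ext <;> simp <;> ring
  have hmeas : ∀ η : ℝ, 0 < η → AEStronglyMeasurable
      (fun x => ∫ y, ((x - y) / ((x - y) ^ 2 + η ^ 2)) • f y) volume := by
    intro η hη
    rw [hdecomp η hη]
    have h1 := continuous_conjPoissonExt hre.integrable hη
    have h2 := continuous_conjPoissonExt him.integrable hη
    exact Continuous.aestronglyMeasurable (by fun_prop)
  have hbound : ∀ η : ℝ, 0 < η →
      eLpNorm (fun x => ∫ y, ((x - y) / ((x - y) ^ 2 + η ^ 2)) • f y) (ENNReal.ofReal p) volume
        ≤ (2 * C : ℝ≥0) * eLpNorm f (ENNReal.ofReal p) volume := by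
    intro η hη
    have h1 := continuous_conjPoissonExt hre.integrable hη
    have h2 := continuous_conjPoissonExt him.integrable hη
    rw [hdecomp η hη]
    refine (eLpNorm_add_le (Continuous.aestronglyMeasurable (by fun_prop))
      (Continuous.aestronglyMeasurable (by fun_prop)) hq).trans ?_
    have e1 : eLpNorm (fun x => (conjPoissonExt η (fun y => (f y).re) x : ℂ)) (ENNReal.ofReal p)
        volume ≤ C * eLpNorm f (ENNReal.ofReal p) volume := by
      refine (eLpNorm_mono fun x => by simp).trans ((hC η hη _ hre).trans ?_)
      gcongr
      exact eLpNorm_mono fun x => Complex.abs_re_le_norm _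
    have e2 : eLpNorm (fun x => Complex.I * (conjPoissonExt η (fun y => (f y).im) x : ℂ))
        (ENNReal.ofReal p) volume ≤ C * eLpNorm f (ENNReal.ofReal p) volume := by
      refine (eLpNorm_mono fun x => by simp).trans ((hC η hη _ him).trans ?_)
      gcongr
      exact eLpNorm_mono fun x => Complex.abs_im_le_norm _
    refine (add_le_add e1 e2).trans_eq ?_
    push_cast
    ring
  have hlim := tendsto_hilbertPV_conjPoisson hL hc
  have hη : ∀ n : ℕ, 0 < 1 / ((n : ℝ) + 1) := fun n => Nat.one_div_pos_of_nat
  refine ⟨aestronglyMeasurable_of_tendsto_ae atTop (fun n => hmeas _ (hη n)) (ae_of_all _ hlim), ?_⟩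
  refine (Lp.eLpNorm_lim_le_liminf_eLpNorm (fun n => hmeas _ (hη n)) _ (ae_of_all _ hlim)).trans ?_
  exact liminf_le_of_frequently_le' (Frequently.of_forall fun n => hbound _ (hη n))

theorem lintegral_eq_mul_lintegral_comp_mul {g : ℝ → ℝ≥0∞} (hg : Measurable g) {a : ℝ}
    (ha : 0 < a) : ∫⁻ y, g y = ENNReal.ofReal a * ∫⁻ t, g (a * t) := by
  conv_lhs => rw [← Real.smul_map_volume_mul_left ha.ne']
  rw [lintegral_smul_measure, lintegral_map hg (measurable_const_mul a), abs_of_pos ha, smul_eq_mul]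

theorem eq_zero_of_tsupport_subset_Ioi {f : ℝ → ℂ} (hs : tsupport f ⊆ Ioi 0) {y : ℝ} (hy : y ≤ 0) :
    f y = 0 := by
  by_contra h
  exact (not_lt.2 hy) (hs (subset_tsupport f h))

/-- The function whose Hilbert transform at `x` is `(π/2) (K_α f)(x)`. -/
noncomputable def weighted (α : ℝ) (f : ℝ → ℂ) (x y : ℝ) : ℂ :=
  (x ^ α * y ^ (1 - α) / (x + y)) • f y

section Weighted

variable {α : ℝ} {f : ℝ → ℂ} {x : ℝ}

theorem contDiff_weighted (hf : ContDiff ℝ (⊤ : ℕ∞) f) (hs : tsupport f ⊆ Ioi 0) (hx : 0 < x) :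
    ContDiff ℝ (⊤ : ℕ∞) (weighted α f x) := by
  refine contDiff_iff_contDiffAt.2 fun y => ?_
  by_cases hy : y ∈ tsupport f
  · have hy0 : 0 < y := hs hy
    have h1 : ContDiffAt ℝ (⊤ : ℕ∞) (fun y : ℝ => x ^ α * y ^ (1 - α) / (x + y)) y :=
      (contDiffAt_const.mul (contDiffAt_id.rpow_const_of_ne hy0.ne')).div
        (contDiffAt_const.add contDiffAt_id) (by positivity)
    exact h1.smul hf.contDiffAt
  · have h := notMem_tsupport_iff_eventuallyEq.1 hy
    refine (contDiffAt_const (c := (0 : ℂ))).congr_of_eventuallyEq (h.mono fun z hz => ?_)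
    simp [weighted, hz]

theorem hasCompactSupport_weighted (hc : HasCompactSupport f) :
    HasCompactSupport (weighted α f x) :=
  hc.smul_left (f := fun y : ℝ => x ^ α * y ^ (1 - α) / (x + y))

theorem KalphaTrunc_eq (hs : tsupport f ⊆ Ioi 0) (ε : ℝ) :
    KalphaTrunc α f x ε =
      (2 / Real.pi) • ∫ y, (if ε < |x - y| then (x - y)⁻¹ else 0) • weighted α f x y := by
  have hm : MeasurableSet {y : ℝ | y ∈ Ioi (0 : ℝ) ∧ ε < |y - x|} :=
    measurableSet_Ioi.inter (measurableSet_lt measurable_const (by fun_prop : Measurable fun y : ℝ => |y - x|))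
  rw [KalphaTrunc, ← integral_indicator hm]
  congr 2; ext y
  simp only [indicator, mem_ofPred_eq, mem_Ioi, weighted, abs_sub_comm x y]
  by_cases hy : 0 < y
  · by_cases hε : ε < |y - x|
    · rw [if_pos ⟨hy, hε⟩, if_pos hε, smul_smul]
      congr 1
      rw [show x ^ 2 - y ^ 2 = (x - y) * (x + y) by ring, div_eq_mul_inv, div_eq_mul_inv, mul_inv]
      ring
    · rw [if_neg (fun h => hε h.2), if_neg hε, zero_smul]
  · rw [if_neg (fun h => hy h.1), eq_zero_of_tsupport_subset_Ioi hs (not_lt.1 hy), smul_zero,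
      smul_zero]

theorem tendsto_KalphaTrunc (hf : ContDiff ℝ (⊤ : ℕ∞) f) (hc : HasCompactSupport f)
    (hs : tsupport f ⊆ Ioi 0) (hx : 0 < x) :
    Tendsto (KalphaTrunc α f x) (nhdsWithin (0 : ℝ) (Ioi 0))
      (nhds ((2 / Real.pi) • hilbertPV (weighted α f x) x)) := by
  obtain ⟨L, hL⟩ := ContDiff.lipschitzWith_of_hasCompactSupport
    (hasCompactSupport_weighted (α := α) (x := x) hc) (contDiff_weighted hf hs hx) (by simp)
  refine ((tendsto_hilbertPV_trunc hL (hasCompactSupport_weighted hc) x).const_smul _).congr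
    fun ε => ?_
  rw [KalphaTrunc_eq hs]

theorem Kalpha_eq (hf : ContDiff ℝ (⊤ : ℕ∞) f) (hc : HasCompactSupport f)
    (hs : tsupport f ⊆ Ioi 0) (hx : 0 < x) :
    Kalpha α f x = (2 / Real.pi) • hilbertPV (weighted α f x) x :=
  (tendsto_KalphaTrunc hf hc hs hx).limUnder_eq

end Weighted

theorem enorm_hilbertPV_le {E : Type*} [NormedAddCommGroup E] [NormedSpace ℝ E] {φ : ℝ → E}
    {L : ℝ≥0} (hL : LipschitzWith L φ) (hc : HasCompactSupport φ) (x : ℝ) :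
    ‖hilbertPV φ x‖ₑ ≤ ∫⁻ y, ‖(x - y)⁻¹ • φ y‖ₑ := by
  refine le_of_tendsto (tendsto_hilbertPV_trunc hL hc x).enorm (Eventually.of_forall fun ε => ?_)
  refine (enorm_integral_le_lintegral_enorm _).trans (lintegral_mono fun y => ?_)
  dsimp only
  split_ifs
  · exact le_rfl
  · simp

/-- The homogeneous kernel of `(π/2) K_α` minus half of the Hilbert kernel, restricted to `x = 1`. -/
noncomputable def diffKernel (α t : ℝ) : ℝ := (1 - t)⁻¹ * (t ^ (1 - α) / (1 + t) - 1 / 2)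

theorem measurable_diffKernel (α : ℝ) : Measurable (diffKernel α) := by
  unfold diffKernel; fun_prop

theorem exists_diffKernel_le_near_one (α : ℝ) :
    ∃ C δ : ℝ, 0 ≤ C ∧ 0 < δ ∧ ∀ t, |t - 1| < δ → |diffKernel α t| ≤ C := by
  have hd : DifferentiableAt ℝ (fun t : ℝ => t ^ (1 - α) / (1 + t) - 1 / 2) 1 := by
    refine DifferentiableAt.sub_const (DifferentiableAt.div ?_ ?_ (by norm_num)) _
    · exact differentiableAt_id.rpow_const (Or.inl one_ne_zero)
    · fun_prop
  obtain ⟨C, hC⟩ := hd.isBigO_sub.bound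
  obtain ⟨δ, hδ, h⟩ := Metric.eventually_nhds_iff.1 hC
  refine ⟨max C 0, δ, le_max_right _ _, hδ, fun t ht => ?_⟩
  have h1 := h (y := t) (by rwa [Real.dist_eq])
  rw [Real.one_rpow, show (1 : ℝ) / (1 + 1) - 1 / 2 = 0 by norm_num, sub_zero, Real.norm_eq_abs,
    Real.norm_eq_abs] at h1
  rw [diffKernel, abs_mul, abs_inv, abs_sub_comm 1 t]
  rcases eq_or_ne t 1 with rfl | hne
  · simp
  · rw [inv_mul_le_iff₀ (abs_pos.2 (sub_ne_zero.2 hne)), mul_comm |t - 1|]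
    exact h1.trans (by gcongr; exact le_max_left _ _)

theorem exists_diffKernel_le (α : ℝ) :
    ∃ C : ℝ, 0 ≤ C ∧ (∀ t, 0 < t → t ≤ 1 → |diffKernel α t| ≤ C * (1 + t ^ (1 - α))) ∧
      ∀ t, 1 < t → |diffKernel α t| ≤ C * (t ^ (-1 : ℝ) + t ^ (-1 - α)) := by
  obtain ⟨C, δ, hC, hδ, h⟩ := exists_diffKernel_le_near_one α
  have hmain : ∀ t, 0 < t → δ ≤ |t - 1| →
      |diffKernel α t| ≤ |t - 1|⁻¹ * (1 + t ^ (1 - α) / (1 + t)) := by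
    intro t ht hd
    rw [diffKernel, abs_mul, abs_inv, abs_sub_comm 1 t]
    gcongr
    have : 0 ≤ t ^ (1 - α) / (1 + t) := by positivity
    rw [abs_le]
    constructor <;> linarith
  refine ⟨(1 + δ) * C + (1 + δ⁻¹), by positivity, fun t ht ht1 => ?_, fun t ht => ?_⟩
  · have hpow : 0 ≤ t ^ (1 - α) := by positivity
    have hδi : 0 < δ⁻¹ := by positivity
    rcases lt_or_ge |t - 1| δ with hd | hd
    · have := h t hd
      have h2 : 0 ≤ ((1 + δ) * C + (1 + δ⁻¹)) * t ^ (1 - α) := by positivity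
      nlinarith [mul_nonneg hδ.le hC]
    · calc |diffKernel α t| ≤ |t - 1|⁻¹ * (1 + t ^ (1 - α) / (1 + t)) := hmain t ht hd
        _ ≤ δ⁻¹ * (1 + t ^ (1 - α)) := by
            gcongr
            exact div_le_self hpow (by linarith)
        _ ≤ _ := by
            gcongr
            nlinarith [mul_nonneg hδ.le hC]
  · have ht0 : 0 < t := by linarith
    have e1 : t ^ (-1 : ℝ) = t⁻¹ := Real.rpow_neg_one t
    have e2 : t ^ (-1 - α) = t⁻¹ * t ^ (-α) := by
      rw [sub_eq_add_neg, Real.rpow_add ht0, e1]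
    have e3 : t ^ (1 - α) = t * t ^ (-α) := by
      rw [sub_eq_add_neg, Real.rpow_add ht0, Real.rpow_one]
    have hpow : 0 ≤ t ^ (-α) := by positivity
    have hδi : 0 < δ⁻¹ := by positivity
    rw [e1, e2, show t⁻¹ + t⁻¹ * t ^ (-α) = t⁻¹ * (1 + t ^ (-α)) by ring, ← mul_assoc,
      ← div_eq_mul_inv]
    have hfar := hmain t ht0
    rw [abs_of_pos (by linarith : (0 : ℝ) < t - 1)] at hfar
    rcases lt_or_ge (t - 1) δ with hd | hd
    · have h1 := h t (by rwa [abs_of_pos (by linarith)])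
      have h2 : C ≤ ((1 + δ) * C + (1 + δ⁻¹)) / t := by
        rw [le_div_iff₀ ht0]
        nlinarith
      refine (h1.trans h2).trans (le_mul_of_one_le_right (hC.trans h2) (by linarith))
    · calc |diffKernel α t| ≤ (t - 1)⁻¹ * (1 + t ^ (1 - α) / (1 + t)) := hfar hd
        _ ≤ ((1 + δ⁻¹) / t) * (1 + t ^ (-α)) := by
            gcongr
            · have h3 : 0 < t - 1 := by linarith
              rw [inv_le_iff_one_le_mul₀ h3, div_mul_eq_mul_div, le_div_iff₀ ht0]
              have : 1 ≤ δ⁻¹ * (t - 1) := by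
                rw [inv_mul_eq_div, le_div_iff₀ hδ]; linarith
              linarith
            · rw [e3, div_le_iff₀ (by linarith)]
              nlinarith
        _ ≤ _ := by
            refine mul_le_mul_of_nonneg_right (div_le_div_of_nonneg_right
              (le_add_of_nonneg_left (by positivity)) ht0.le) (by positivity)

theorem integrableOn_diffKernel_mul_rpow {α p : ℝ} (hp : 1 < p)
    (hα : α ∈ Ioo (-(1 / p)) (2 - 1 / p)) :
    IntegrableOn (fun t => |diffKernel α t| * t ^ (-(1 / p))) (Ioi 0) := by
  obtain ⟨C, hC, h1, h2⟩ := exists_diffKernel_le α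
  have hp0 : 0 < p := by linarith
  have hp1 : 1 / p < 1 := by rw [div_lt_one hp0]; exact hp
  have hpi : 0 < 1 / p := by positivity
  have hmeas : Measurable fun t => |diffKernel α t| * t ^ (-(1 / p)) :=
    (measurable_diffKernel α).abs.mul (measurable_id.pow_const _)
  rw [← Ioc_union_Ioi_eq_Ioi zero_le_one]
  refine IntegrableOn.union ?_ ?_
  · have hpow : ∀ s : ℝ, -1 < s → IntegrableOn (fun t : ℝ => t ^ s) (Ioc 0 1) := fun s hs => by
      rw [integrableOn_Ioc_iff_integrableOn_Ioo, intervalIntegral.integrableOn_Ioo_rpow_iff one_pos]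
      exact hs
    refine Integrable.mono' (((hpow (-(1 / p)) (by linarith)).add
      (hpow (1 - α - 1 / p) (by linarith [hα.2]))).const_mul C) hmeas.aestronglyMeasurable ?_
    refine ae_restrict_of_forall_mem measurableSet_Ioc fun t ht => ?_
    have ht0 : 0 < t := ht.1
    rw [Real.norm_of_nonneg (by positivity)]
    calc |diffKernel α t| * t ^ (-(1 / p)) ≤ C * (1 + t ^ (1 - α)) * t ^ (-(1 / p)) := by
          gcongr; exact h1 t ht0 ht.2
      _ = _ := by
          rw [Pi.add_apply, sub_eq_add_neg (1 - α), Real.rpow_add ht0 (1 - α)]; ring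
  · refine Integrable.mono' (((integrableOn_Ioi_rpow_of_lt (a := -1 - 1 / p) (by linarith)
      one_pos).add (integrableOn_Ioi_rpow_of_lt (a := -1 - α - 1 / p) (by linarith [hα.1])
      one_pos)).const_mul C) hmeas.aestronglyMeasurable ?_
    refine ae_restrict_of_forall_mem measurableSet_Ioi fun t ht => ?_
    have ht1 : 1 < t := ht
    have ht0 : 0 < t := by linarith
    rw [Real.norm_of_nonneg (by positivity)]
    calc |diffKernel α t| * t ^ (-(1 / p))
        ≤ C * (t ^ (-1 : ℝ) + t ^ (-1 - α)) * t ^ (-(1 / p)) := by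
          gcongr; exact h2 t ht
      _ = _ := by
          rw [Pi.add_apply, sub_eq_add_neg (-1 - α), Real.rpow_add ht0 (-1 - α),
            sub_eq_add_neg (-1 : ℝ) (1 / p), Real.rpow_add ht0 (-1 : ℝ)]
          ring

theorem hilbertPV_add {φ ψ : ℝ → ℂ} {L M : ℝ≥0} (hφ : LipschitzWith L φ)
    (hφc : HasCompactSupport φ) (hψ : LipschitzWith M ψ) (hψc : HasCompactSupport ψ) (x : ℝ) :
    hilbertPV (φ + ψ) x = hilbertPV φ x + hilbertPV ψ x := by
  rw [hilbertPV, hilbertPV, hilbertPV, ← integral_add (integrableOn_hilbertPV hφ hφc x)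
    (integrableOn_hilbertPV hψ hψc x)]
  refine integral_congr_ae (Eventually.of_forall fun t => ?_)
  simp only [Pi.add_apply, ← smul_add]
  congr 1; ring

theorem hilbertPV_const_smul (c : ℝ) (φ : ℝ → ℂ) (x : ℝ) :
    hilbertPV (c • φ) x = c • hilbertPV φ x := by
  rw [hilbertPV, hilbertPV, ← integral_smul]
  refine integral_congr_ae (Eventually.of_forall fun t => ?_)
  simp only [Pi.smul_apply, ← smul_sub, smul_comm c]

/-- The majorant of the difference between `(π/2) K_α f` and half of the Hilbert transform of `f`. -/
noncomputable def diffMajorant (α : ℝ) (f : ℝ → ℂ) (x : ℝ) : ℝ≥0∞ :=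
  ∫⁻ t in Ioi 0, ‖diffKernel α t‖ₑ * ‖f (x * t)‖ₑ

section Bound

variable {α p : ℝ} {f : ℝ → ℂ}

theorem measurable_diffMajorant (hf : Continuous f) : Measurable (diffMajorant α f) := by
  have h : Measurable fun z : ℝ × ℝ => ‖diffKernel α z.2‖ₑ * ‖f (z.1 * z.2)‖ₑ :=
    ((measurable_diffKernel α).comp measurable_snd).enorm.mul
      (hf.measurable.comp (by fun_prop)).enorm
  exact h.lintegral_prod_right'

theorem lintegral_weighted_sub_le (hf : Continuous f) (hs : tsupport f ⊆ Ioi 0) {x : ℝ}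
    (hx : 0 < x) :
    ∫⁻ y, ‖(x - y)⁻¹ • (weighted α f x y - (1 / 2 : ℝ) • f y)‖ₑ = diffMajorant α f x := by
  have hm : Measurable fun y => ‖(x - y)⁻¹ • (weighted α f x y - (1 / 2 : ℝ) • f y)‖ₑ := by
    have := hf.measurable
    unfold weighted
    fun_prop
  rw [lintegral_eq_mul_lintegral_comp_mul hm hx, ← lintegral_const_mul' _ _ ENNReal.ofReal_ne_top,
    diffMajorant, ← lintegral_indicator measurableSet_Ioi]
  refine lintegral_congr fun t => ?_
  by_cases ht : 0 < t
  · rw [indicator_of_mem (mem_Ioi.2 ht), weighted, ← sub_smul, smul_smul, enorm_smul, ← mul_assoc,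
      ← Real.enorm_of_nonneg hx.le, ← enorm_mul]
    congr 2
    rw [diffKernel, Real.mul_rpow hx.le ht.le, ← mul_assoc (x ^ α), ← Real.rpow_add hx,
      show α + (1 - α) = 1 by ring, Real.rpow_one, show x - x * t = x * (1 - t) by ring,
      show x + x * t = x * (1 + t) by ring, mul_div_mul_left _ _ hx.ne', mul_inv]
    field_simp
  · have h0 : f (x * t) = 0 :=
      eq_zero_of_tsupport_subset_Ioi hs (mul_nonpos_of_nonneg_of_nonpos hx.le (not_lt.1 ht))
    simp [indicator, ht, weighted, h0]

theorem enorm_Kalpha_le (hf : ContDiff ℝ (⊤ : ℕ∞) f) (hc : HasCompactSupport f)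
    (hs : tsupport f ⊆ Ioi 0) {x : ℝ} (hx : 0 < x) :
    ‖Kalpha α f x‖ₑ ≤ ‖hilbertPV f x‖ₑ + diffMajorant α f x := by
  have hw := contDiff_weighted (α := α) hf hs hx
  have hwc := hasCompactSupport_weighted (α := α) (x := x) hc
  have hh : ContDiff ℝ (⊤ : ℕ∞) ((1 / 2 : ℝ) • f) := contDiff_const.smul hf
  have hhc : HasCompactSupport ((1 / 2 : ℝ) • f) := hc.smul_left (f := fun _ : ℝ => (1 / 2 : ℝ))
  have hd : ContDiff ℝ (⊤ : ℕ∞) (weighted α f x - (1 / 2 : ℝ) • f) := hw.sub hh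
  have hdc : HasCompactSupport (weighted α f x - (1 / 2 : ℝ) • f) := hwc.sub hhc
  obtain ⟨L, hL⟩ := ContDiff.lipschitzWith_of_hasCompactSupport hhc hh (by simp)
  obtain ⟨M, hM⟩ := ContDiff.lipschitzWith_of_hasCompactSupport hdc hd (by simp)
  have key : hilbertPV (weighted α f x) x =
      (1 / 2 : ℝ) • hilbertPV f x + hilbertPV (weighted α f x - (1 / 2 : ℝ) • f) x := by
    rw [← hilbertPV_const_smul, ← hilbertPV_add hL hhc hM hdc, add_sub_cancel]
  have hpi : ‖(2 / Real.pi : ℝ)‖ₑ ≤ 1 := by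
    rw [Real.enorm_of_nonneg (by positivity), ENNReal.ofReal_le_one,
      div_le_one Real.pi_pos]
    exact Real.two_le_pi
  have hhalf : ‖(1 / 2 : ℝ)‖ₑ ≤ 1 := by
    rw [Real.enorm_of_nonneg (by positivity), ENNReal.ofReal_le_one]
    norm_num
  rw [Kalpha_eq hf hc hs hx, key, enorm_smul]
  calc ‖(2 / Real.pi : ℝ)‖ₑ * ‖(1 / 2 : ℝ) • hilbertPV f x +
        hilbertPV (weighted α f x - (1 / 2 : ℝ) • f) x‖ₑ
      ≤ 1 * (‖(1 / 2 : ℝ) • hilbertPV f x‖ₑ +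
        ‖hilbertPV (weighted α f x - (1 / 2 : ℝ) • f) x‖ₑ) := by
        gcongr
        exact enorm_add_le _ _
    _ ≤ 1 * (1 * ‖hilbertPV f x‖ₑ + diffMajorant α f x) := by
        rw [enorm_smul]
        gcongr
        exact (enorm_hilbertPV_le hM hdc x).trans_eq
          (lintegral_weighted_sub_le hf.continuous hs hx)
    _ = _ := by rw [one_mul, one_mul]

theorem lintegral_diffMajorant_rpow_le (hp : 1 < p) (hα : α ∈ Ioo (-(1 / p)) (2 - 1 / p)) :
    ∃ C : ℝ≥0, ∀ f : ℝ → ℂ, Continuous f → tsupport f ⊆ Ioi 0 →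
      ∫⁻ x in Ioi 0, diffMajorant α f x ^ p ≤ (C : ℝ≥0∞) ^ p * ∫⁻ x in Ioi 0, ‖f x‖ₑ ^ p := by
  have hp0 : 0 < p := by linarith
  set w : ℝ → ℝ≥0∞ := fun t => ENNReal.ofReal (|diffKernel α t| * t ^ (-(1 / p))) with hw
  have hwm : Measurable w :=
    ((measurable_diffKernel α).abs.mul (measurable_id.pow_const _)).ennreal_ofReal
  set ν : Measure ℝ := (volume.restrict (Ioi 0)).withDensity w with hν
  have hfin : ν univ ≠ ∞ := by
    rw [hν, withDensity_apply _ MeasurableSet.univ, Measure.restrict_univ]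
    exact (integrableOn_diffKernel_mul_rpow hp hα).lintegral_lt_top.ne
  refine ⟨(ν univ).toNNReal, fun f hf hs => ?_⟩
  rw [ENNReal.coe_toNNReal hfin]
  set g : ℝ → ℝ → ℝ≥0∞ := fun x t => ENNReal.ofReal (t ^ (1 / p)) * ‖f (x * t)‖ₑ with hg
  have hgm : Measurable (Function.uncurry g) := by
    have := hf.measurable
    simp only [hg, Function.uncurry_def]
    fun_prop
  have hE : ∀ x, diffMajorant α f x = ∫⁻ t, g x t ∂ν := fun x => by
    have hgx : Measurable (g x) := hgm.comp (measurable_const.prodMk measurable_id)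
    rw [hν, lintegral_withDensity_eq_lintegral_mul _ hwm hgx, diffMajorant]
    refine setLIntegral_congr_fun measurableSet_Ioi fun t ht => ?_
    have ht0 : 0 < t := ht
    simp only [Pi.mul_apply, hw, hg]
    rw [← mul_assoc, ← ENNReal.ofReal_mul (by positivity), mul_assoc |diffKernel α t|,
      ← Real.rpow_add ht0, neg_add_cancel, Real.rpow_zero, mul_one, ← Real.norm_eq_abs,
      ofReal_norm]
  simp only [hE]
  refine lintegral_lintegral_rpow_le hp hgm ?_
  refine (withDensity_absolutelyContinuous _ _).ae_le ?_
  refine ae_restrict_of_forall_mem measurableSet_Ioi fun t ht => ?_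
  have ht0 : 0 < t := ht
  have hvan : ∀ h : ℝ → ℝ, (∀ x ≤ 0, h x ≤ 0) →
      ∫⁻ x in Ioi 0, ‖f (h x)‖ₑ ^ p = ∫⁻ x, ‖f (h x)‖ₑ ^ p := fun h hh => by
    rw [← lintegral_indicator measurableSet_Ioi]
    refine lintegral_congr fun x => ?_
    by_cases hx : 0 < x
    · simp [indicator, hx]
    · rw [eq_zero_of_tsupport_subset_Ioi hs (hh x (not_lt.1 hx))]
      simp [indicator, hx, hp0]
  have hmeas : Measurable fun x => ‖f x‖ₑ ^ p := by
    have := hf.measurable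
    fun_prop
  have hid : ∫⁻ x in Ioi 0, ‖f x‖ₑ ^ p = ∫⁻ x, ‖f x‖ₑ ^ p := hvan id fun x hx => hx
  rw [hid, lintegral_eq_mul_lintegral_comp_mul hmeas ht0,
    ← hvan (fun x => t * x) fun x hx => mul_nonpos_of_nonneg_of_nonpos ht0.le hx,
    ← lintegral_const_mul' _ _ ENNReal.ofReal_ne_top]
  refine lintegral_mono fun x => ?_
  simp only [hg]
  rw [ENNReal.mul_rpow_of_nonneg _ _ hp0.le, ENNReal.ofReal_rpow_of_nonneg (by positivity) hp0.le,
    ← Real.rpow_mul ht0.le, one_div_mul_cancel hp0.ne', Real.rpow_one, mul_comm x]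

theorem exists_eLpNorm_Kalpha_le (hp : 1 < p) (hα : α ∈ Ioo (-(1 / p)) (2 - 1 / p)) :
    ∃ C : ℝ, 0 < C ∧ ∀ f : ℝ → ℂ, ContDiff ℝ (⊤ : ℕ∞) f → HasCompactSupport f →
      tsupport f ⊆ Ioi 0 →
      eLpNorm (Kalpha α f) (ENNReal.ofReal p) (volume.restrict (Ioi 0))
        ≤ ENNReal.ofReal C * eLpNorm f (ENNReal.ofReal p) (volume.restrict (Ioi 0)) := by
  have hp0 : 0 < p := by linarith
  obtain ⟨A, hA⟩ := exists_eLpNorm_hilbertPV_le hp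
  obtain ⟨B, hB⟩ := lintegral_diffMajorant_rpow_le hp hα
  refine ⟨A + B + 1, by positivity, fun f hf hc hs => ?_⟩
  obtain ⟨hHm, hHb⟩ := hA f (ContDiff.lipschitzWith_of_hasCompactSupport hc hf (by simp)) hc
  have hfres : eLpNorm f (ENNReal.ofReal p) volume =
      eLpNorm f (ENNReal.ofReal p) (volume.restrict (Ioi 0)) := by
    rw [← eLpNorm_indicator_eq_eLpNorm_restrict measurableSet_Ioi]
    congr 1
    refine (indicator_eq_self.2 ?_).symm
    exact (subset_tsupport f).trans hs
  have hHn : (∫⁻ x in Ioi 0, ‖hilbertPV f x‖ₑ ^ p) ^ (1 / p) ≤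
      A * eLpNorm f (ENNReal.ofReal p) (volume.restrict (Ioi 0)) := by
    rw [← eLpNorm_ofReal_eq hp0, ← hfres]
    exact (eLpNorm_mono_measure _ Measure.restrict_le_self).trans hHb
  have hEn : (∫⁻ x in Ioi 0, diffMajorant α f x ^ p) ^ (1 / p) ≤
      B * eLpNorm f (ENNReal.ofReal p) (volume.restrict (Ioi 0)) := by
    rw [eLpNorm_ofReal_eq hp0]
    refine (ENNReal.rpow_le_rpow (hB f hf.continuous hs) (by positivity)).trans_eq ?_
    rw [ENNReal.mul_rpow_of_nonneg _ _ (by positivity), ← ENNReal.rpow_mul,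
      mul_one_div_cancel hp0.ne', ENNReal.rpow_one]
  calc eLpNorm (Kalpha α f) (ENNReal.ofReal p) (volume.restrict (Ioi 0))
      = (∫⁻ x in Ioi 0, ‖Kalpha α f x‖ₑ ^ p) ^ (1 / p) := eLpNorm_ofReal_eq hp0 _
    _ ≤ (∫⁻ x in Ioi 0, ((fun x => ‖hilbertPV f x‖ₑ) + diffMajorant α f) x ^ p) ^ (1 / p) := by
        refine ENNReal.rpow_le_rpow (setLIntegral_mono' measurableSet_Ioi fun x hx => ?_)
          (by positivity)
        exact ENNReal.rpow_le_rpow (enorm_Kalpha_le hf hc hs hx) hp0.le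
    _ ≤ (∫⁻ x in Ioi 0, ‖hilbertPV f x‖ₑ ^ p) ^ (1 / p) +
        (∫⁻ x in Ioi 0, diffMajorant α f x ^ p) ^ (1 / p) :=
        ENNReal.lintegral_Lp_add_le hHm.restrict.enorm
          (measurable_diffMajorant hf.continuous).aemeasurable hp.le
    _ ≤ A * eLpNorm f (ENNReal.ofReal p) (volume.restrict (Ioi 0)) +
        B * eLpNorm f (ENNReal.ofReal p) (volume.restrict (Ioi 0)) := add_le_add hHn hEn
    _ ≤ _ := by
        rw [← add_mul]
        gcongr
        rw [ENNReal.ofReal_add (by positivity) one_pos.le, ENNReal.ofReal_add A.coe_nonneg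
          B.coe_nonneg, ENNReal.ofReal_coe_nnreal, ENNReal.ofReal_coe_nnreal]
        exact le_self_add

end Bound

theorem integrableOn_rpow_of_le_enorm {p β c : ℝ} (hp : 0 < p) (hc : 0 < c) {F : ℝ → ℂ} {s : Set ℝ}
    (hs : MeasurableSet s) (hs0 : s ⊆ Ioi 0) (hF : ∀ x ∈ s, c * x ^ β ≤ ‖F x‖)
    (hfin : eLpNorm F (ENNReal.ofReal p) (volume.restrict (Ioi 0)) ≠ ∞) :
    IntegrableOn (fun x : ℝ => x ^ (β * p)) s := by
  refine ⟨(measurable_id.pow_const _).aestronglyMeasurable, ?_⟩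
  rw [eLpNorm_ofReal_eq hp] at hfin
  have hfin' : ∫⁻ x in Ioi 0, ‖F x‖ₑ ^ p ≠ ∞ := fun h => hfin (by
    rw [h, ENNReal.top_rpow_of_pos (by positivity)])
  have hle : ∫⁻ x in s, ‖x ^ (β * p)‖ₑ ≤
      ∫⁻ x in s, ENNReal.ofReal (c⁻¹) ^ p * ‖F x‖ₑ ^ p := by
    refine setLIntegral_mono' hs fun x hx => ?_
    have hx0 : 0 < x := hs0 hx
    rw [← ENNReal.mul_rpow_of_nonneg _ _ hp.le, Real.rpow_mul hx0.le,
      Real.enorm_of_nonneg (by positivity), ← ENNReal.ofReal_rpow_of_nonneg (by positivity) hp.le,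
      ← ofReal_norm, ← ENNReal.ofReal_mul (by positivity)]
    gcongr
    rw [le_inv_mul_iff₀ hc]
    exact hF x hx
  refine hle.trans_lt ?_
  rw [lintegral_const_mul' _ _ (ENNReal.rpow_ne_top_of_nonneg hp.le ENNReal.ofReal_ne_top)]
  refine ENNReal.mul_lt_top (ENNReal.rpow_lt_top_of_nonneg hp.le ENNReal.ofReal_ne_top) ?_
  exact (lintegral_mono_set hs0).trans_lt hfin'.lt_top

/-- A smooth bump supported on `[1, 2]`. -/
noncomputable def testBump : ContDiffBump (3 / 2 : ℝ) := ⟨1 / 4, 1 / 2, by norm_num, by norm_num⟩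

/-- The complex-valued test function given by `testBump`. -/
noncomputable def testFun (y : ℝ) : ℂ := (testBump y : ℝ)

theorem testBump_pos {y : ℝ} (hy : y ∈ Ioo (1 : ℝ) 2) : 0 < testBump y := by
  refine testBump.pos_of_mem_ball ?_
  rw [Real.ball_eq_Ioo]
  simp only [testBump]
  exact ⟨by linarith [hy.1], by linarith [hy.2]⟩

theorem tsupport_testFun_subset : tsupport testFun ⊆ Icc 1 2 := by
  have h : tsupport testFun ⊆ tsupport testBump := closure_mono fun y hy => by
    simpa [testFun] using hy
  refine h.trans ?_
  rw [testBump.tsupport_eq, Real.closedBall_eq_Icc]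
  simp only [testBump]
  exact Icc_subset_Icc (by norm_num) (by norm_num)

theorem contDiff_testFun : ContDiff ℝ (⊤ : ℕ∞) testFun :=
  Complex.ofRealCLM.contDiff.comp testBump.contDiff

theorem hasCompactSupport_testFun : HasCompactSupport testFun :=
  isCompact_Icc.of_isClosed_subset (isClosed_tsupport _) tsupport_testFun_subset

theorem tsupport_testFun_subset_Ioi : tsupport testFun ⊆ Ioi 0 :=
  tsupport_testFun_subset.trans fun _ hy => lt_of_lt_of_le one_pos hy.1

theorem Kalpha_testFun {α x δ : ℝ} (hδ : 0 < δ) (h : ∀ y ∈ Icc (1 : ℝ) 2, δ ≤ |y - x|) :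
    Kalpha α testFun x = ((2 / Real.pi *
      ∫ y in (1 : ℝ)..2, x ^ α * y ^ (1 - α) / (x ^ 2 - y ^ 2) * testBump y : ℝ) : ℂ) := by
  refine Tendsto.limUnder_eq (tendsto_const_nhds.congr' ?_)
  filter_upwards [Ioo_mem_nhdsGT hδ] with ε hε
  have hsub : Icc (1 : ℝ) 2 ⊆ {y : ℝ | y ∈ Ioi (0 : ℝ) ∧ ε < |y - x|} := fun y hy =>
    ⟨lt_of_lt_of_le one_pos hy.1, hε.2.trans_le (h y hy)⟩
  have hm : MeasurableSet {y : ℝ | y ∈ Ioi (0 : ℝ) ∧ ε < |y - x|} :=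
    measurableSet_Ioi.inter
      (measurableSet_lt measurable_const (by fun_prop : Measurable fun y : ℝ => |y - x|))
  rw [KalphaTrunc, setIntegral_eq_of_subset_of_forall_sdiff_eq_zero hm hsub fun y hy => by
      rw [image_eq_zero_of_notMem_tsupport fun hy' => hy.2 (tsupport_testFun_subset hy'), smul_zero],
    intervalIntegral.integral_of_le one_le_two, ← integral_Icc_eq_integral_Ioc,
    Complex.ofReal_mul, ← integral_complex_ofReal, ← Complex.real_smul]
  congr 1
  refine integral_congr_ae (Eventually.of_forall fun y => ?_)
  simp [testFun]

theorem continuousOn_rpow_mul_testBump (s : ℝ) :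
    ContinuousOn (fun y : ℝ => y ^ s * testBump y) (uIcc 1 2) := by
  refine ContinuousOn.mul (continuousOn_id.rpow_const fun y hy => Or.inl ?_)
    testBump.continuous.continuousOn
  rw [uIcc_of_le one_le_two] at hy
  exact (lt_of_lt_of_le one_pos hy.1).ne'

theorem integral_rpow_mul_testBump_pos (s : ℝ) : 0 < ∫ y in (1 : ℝ)..2, y ^ s * testBump y := by
  refine intervalIntegral.intervalIntegral_pos_of_pos_on
    (continuousOn_rpow_mul_testBump s).intervalIntegrable (fun y hy => ?_) one_lt_two
  have : 0 < y := one_pos.trans hy.1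
  have := testBump_pos hy
  positivity

theorem continuousOn_kernel_mul_testBump (α : ℝ) {x : ℝ}
    (h : ∀ y ∈ Icc (1 : ℝ) 2, x ^ 2 - y ^ 2 ≠ 0) :
    ContinuousOn (fun y : ℝ => x ^ α * y ^ (1 - α) / (x ^ 2 - y ^ 2) * testBump y) (uIcc 1 2) := by
  rw [uIcc_of_le one_le_two]
  refine ContinuousOn.mul (ContinuousOn.div (continuousOn_const.mul
    (continuousOn_id.rpow_const fun y hy => Or.inl ?_)) (by fun_prop) h)
    testBump.continuous.continuousOn
  exact (lt_of_lt_of_le one_pos hy.1).ne'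

theorem le_norm_Kalpha_testFun_of_lt {α x : ℝ} (hx0 : 0 < x) (hx : x < 1 / 2) :
    2 / Real.pi * (∫ y in (1 : ℝ)..2, y ^ (-1 - α) * testBump y) * x ^ α ≤
      ‖Kalpha α testFun x‖ := by
  rw [Kalpha_testFun (δ := 1 / 2) (by norm_num) fun y hy => by
    rw [le_abs]; left; linarith [hy.1], Complex.norm_real, Real.norm_eq_abs, abs_mul,
    abs_of_pos (by positivity : 0 < 2 / Real.pi), mul_assoc]
  gcongr
  refine le_trans ?_ (neg_le_abs _)
  rw [← intervalIntegral.integral_neg, ← intervalIntegral.integral_mul_const]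
  refine intervalIntegral.integral_mono_on one_le_two
    ((continuousOn_rpow_mul_testBump _).mul continuousOn_const).intervalIntegrable
    (continuousOn_kernel_mul_testBump α fun y hy => ?_).neg.intervalIntegrable fun y hy => ?_
  · nlinarith [hy.1]
  · have hy0 : 0 < y := lt_of_lt_of_le one_pos hy.1
    have hd : 0 < y ^ 2 - x ^ 2 := by nlinarith [hy.1]
    have hb := testBump.nonneg (x := y)
    rw [show x ^ 2 - y ^ 2 = -(y ^ 2 - x ^ 2) by ring, div_neg, neg_mul, neg_neg, mul_right_comm]
    gcongr
    rw [le_div_iff₀ hd, show -1 - α = (1 - α) - 2 by ring, Real.rpow_sub hy0, Real.rpow_two,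
      mul_comm (x ^ α), mul_assoc, div_mul_eq_mul_div, div_le_iff₀ (by positivity), mul_assoc]
    gcongr
    have := Real.rpow_pos_of_pos hx0 α
    nlinarith [sq_nonneg x]

theorem le_norm_Kalpha_testFun_of_gt {α x : ℝ} (hx : 4 < x) :
    2 / Real.pi * (∫ y in (1 : ℝ)..2, y ^ (1 - α) * testBump y) * x ^ (α - 2) ≤
      ‖Kalpha α testFun x‖ := by
  have hx0 : 0 < x := by linarith
  rw [Kalpha_testFun (δ := 1) (by norm_num) fun y hy => by
    rw [le_abs]; right; linarith [hy.2], Complex.norm_real, Real.norm_eq_abs, abs_mul,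
    abs_of_pos (by positivity : 0 < 2 / Real.pi), mul_assoc]
  gcongr
  refine le_trans ?_ (le_abs_self _)
  rw [← intervalIntegral.integral_mul_const]
  refine intervalIntegral.integral_mono_on one_le_two
    ((continuousOn_rpow_mul_testBump _).mul continuousOn_const).intervalIntegrable
    (continuousOn_kernel_mul_testBump α fun y hy => ?_).intervalIntegrable fun y hy => ?_
  · nlinarith [hy.1, hy.2]
  · have hy0 : 0 < y := lt_of_lt_of_le one_pos hy.1
    have hd : 0 < x ^ 2 - y ^ 2 := by nlinarith [hy.2]
    have hb := testBump.nonneg (x := y)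
    rw [mul_right_comm]
    gcongr
    rw [le_div_iff₀ hd, Real.rpow_sub hx0, Real.rpow_two,
      mul_comm (x ^ α), mul_assoc, div_mul_eq_mul_div]
    gcongr
    rw [div_le_iff₀ (by positivity)]
    gcongr
    nlinarith [sq_nonneg y]

theorem mem_Ioo_of_eLpNorm_Kalpha_testFun_ne_top {p α : ℝ} (hp : 0 < p)
    (h : eLpNorm (Kalpha α testFun) (ENNReal.ofReal p) (volume.restrict (Ioi 0)) ≠ ∞) :
    α ∈ Ioo (-(1 / p)) (2 - 1 / p) := by
  have hc : ∀ s : ℝ, 0 < 2 / Real.pi * ∫ y in (1 : ℝ)..2, y ^ s * testBump y := fun s =>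
    mul_pos (by positivity) (integral_rpow_mul_testBump_pos s)
  constructor
  · have h1 := integrableOn_rpow_of_le_enorm hp (hc (-1 - α)) measurableSet_Ioo
      (fun x hx => hx.1) (fun x (hx : x ∈ Ioo (0 : ℝ) (1 / 2)) =>
        le_norm_Kalpha_testFun_of_lt hx.1 hx.2) h
    rw [intervalIntegral.integrableOn_Ioo_rpow_iff (by norm_num)] at h1
    rw [← neg_div, div_lt_iff₀ hp]
    exact h1
  · have h2 := integrableOn_rpow_of_le_enorm hp (hc (1 - α)) measurableSet_Ioi
      (fun x (hx : 4 < x) => lt_trans four_pos hx) (fun x (hx : x ∈ Ioi (4 : ℝ)) =>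
        le_norm_Kalpha_testFun_of_gt hx) h
    rw [integrableOn_Ioi_rpow_iff four_pos] at h2
    have : α - 2 < -1 / p := by rwa [lt_div_iff₀ hp]
    rw [neg_div] at this
    linarith

/-- For `1 < p < ∞` and `α ∈ ℝ`, the principal value defining `(K_α f)(x)`
exists for every `f ∈ C_c^∞((0,∞);ℂ)` and every `x > 0`; moreover a uniform bound
`‖K_α f‖_{L_p((0,∞))} ≤ C ‖f‖_{L_p((0,∞))}` over such `f` holds for some `C > 0`
if and only if `α ∈ (-1/p, 2 - 1/p)`. -/
theorem Kalpha_pv_exists_and_bounded_iff (p : ℝ) (hp : 1 < p) (α : ℝ) :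
    (∀ f : ℝ → ℂ, ContDiff ℝ (⊤ : ℕ∞) f → HasCompactSupport f → tsupport f ⊆ Ioi 0 →
      ∀ x : ℝ, 0 < x →
        ∃ L : ℂ, Tendsto (KalphaTrunc α f x) (nhdsWithin (0 : ℝ) (Ioi 0)) (nhds L)) ∧
    ((∃ C : ℝ, 0 < C ∧ ∀ f : ℝ → ℂ, ContDiff ℝ (⊤ : ℕ∞) f → HasCompactSupport f →
        tsupport f ⊆ Ioi 0 →
        eLpNorm (Kalpha α f) (ENNReal.ofReal p) (volume.restrict (Ioi 0))
          ≤ ENNReal.ofReal C * eLpNorm f (ENNReal.ofReal p) (volume.restrict (Ioi 0))) ↔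
      α ∈ Ioo (-(1 / p)) (2 - 1 / p)) := by
  refine ⟨fun f hf hc hs x hx => ⟨_, tendsto_KalphaTrunc hf hc hs hx⟩, ?_,
    exists_eLpNorm_Kalpha_le hp⟩
  rintro ⟨C, -, hC⟩
  have hmem : MemLp testFun (ENNReal.ofReal p) (volume.restrict (Ioi 0)) :=
    contDiff_testFun.continuous.memLp_of_hasCompactSupport hasCompactSupport_testFun
  refine mem_Ioo_of_eLpNorm_Kalpha_testFun_ne_top (by linarith) (ne_top_of_le_ne_top ?_
    (hC testFun contDiff_testFun hasCompactSupport_testFun tsupport_testFun_subset_Ioi))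
  exact ENNReal.mul_ne_top ENNReal.ofReal_ne_top hmem.eLpNorm_ne_top
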